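/- Let d ≥ 1 be an integer. Every bipartite finite simple graph that contains no induced subgraph isomorphic to the armchair, the stirrer, the tripod, or the complete bipartite graph K_{d+1,d+1} has pathwidth at most 4d − 1. -/

import Mathlib

open SimpleGraph

/-- A path decomposition of a simple graph `G`: a nonempty finite sequence of bags
covering all vertices and edges, such that each vertex occurs in an interval of bags. -/
structure PathDecomp {V : Type*} (G : SimpleGraph V) where
  len : ℕ
  len_pos : 0 < len
  bags : Fin len → Finset V
  mem_bag : ∀ v : V, ∃ i, v ∈ bags i
  edge_bag : ∀ ⦃u v : V⦄, G.Adj u v → ∃ i, u ∈ bags i ∧ v ∈ bags i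
  interval : ∀ (v : V) (i j k : Fin len), i ≤ j → j ≤ k →
    v ∈ bags i → v ∈ bags k → v ∈ bags j

/-- The width of a path decomposition: maximum bag size minus one. -/
def PathDecomp.width {V : Type*} {G : SimpleGraph V} (D : PathDecomp G) : ℕ :=
  (Finset.univ.sup fun i => (D.bags i).card) - 1

/-- The pathwidth of a graph: minimum width over all path decompositions. -/
noncomputable def pathwidth {V : Type*} (G : SimpleGraph V) : ℕ :=
  sInf {w : ℕ | ∃ D : PathDecomp G, D.width = w}

/-- A set of vertices is independent if no two of its members are adjacent. -/
def IndepVertexSet {V : Type*} (G : SimpleGraph V) (A : Set V) : Prop :=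
  ∀ ⦃u⦄, u ∈ A → ∀ ⦃v⦄, v ∈ A → ¬ G.Adj u v

/-- A graph is bipartite if its vertex set is partitioned into two independent sets. -/
def IsBipartiteGraph {V : Type*} (G : SimpleGraph V) : Prop :=
  ∃ A B : Set V, A ∪ B = Set.univ ∧ Disjoint A B ∧
    IndepVertexSet G A ∧ IndepVertexSet G B

/-- `G` contains an induced subgraph isomorphic to `H`. -/
def HasInducedCopy {V W : Type*} (G : SimpleGraph V) (H : SimpleGraph W) : Prop :=
  ∃ S : Set V, Nonempty (G.induce S ≃g H)

/-- The armchair: a 4-cycle 0-1-2-3 with pendant vertices 4, 5, 6 attached to 0, 1, 2. -/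
def armchair : SimpleGraph (Fin 7) :=
  SimpleGraph.fromRel (fun a b =>
    (a = 0 ∧ b = 1) ∨ (a = 1 ∧ b = 2) ∨ (a = 2 ∧ b = 3) ∨ (a = 3 ∧ b = 0) ∨
    (a = 0 ∧ b = 4) ∨ (a = 1 ∧ b = 5) ∨ (a = 2 ∧ b = 6))

/-- The stirrer: two 4-cycles 0-1-2-3 and 0-1-4-5 sharing exactly the edge 0-1,
with a pendant vertex 6 attached to the endpoint 0 of the shared edge. -/
def stirrer : SimpleGraph (Fin 7) :=
  SimpleGraph.fromRel (fun a b =>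
    (a = 0 ∧ b = 1) ∨ (a = 1 ∧ b = 2) ∨ (a = 2 ∧ b = 3) ∨ (a = 3 ∧ b = 0) ∨
    (a = 1 ∧ b = 4) ∨ (a = 4 ∧ b = 5) ∨ (a = 5 ∧ b = 0) ∨ (a = 0 ∧ b = 6))

/-- The tripod: the star K_{1,3} with each edge subdivided once
(centre 0 with paths 0-1-2, 0-3-4, 0-5-6). -/
def tripod : SimpleGraph (Fin 7) :=
  SimpleGraph.fromRel (fun a b =>
    (a = 0 ∧ b = 1) ∨ (a = 1 ∧ b = 2) ∨ (a = 0 ∧ b = 3) ∨ (a = 3 ∧ b = 4) ∨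
    (a = 0 ∧ b = 5) ∨ (a = 5 ∧ b = 6))

/-- A graph is fast if it contains no induced armchair, stirrer or tripod. -/
def Fast {V : Type*} (G : SimpleGraph V) : Prop :=
  ¬ HasInducedCopy G armchair ∧ ¬ HasInducedCopy G stirrer ∧ ¬ HasInducedCopy G tripod

/-- A graph is hole-free if it contains no induced cycle of length at least 5. -/
def HoleFree {V : Type*} (G : SimpleGraph V) : Prop :=
  ∀ n : ℕ, 5 ≤ n → ¬ HasInducedCopy G (SimpleGraph.cycleGraph n)


set_option maxRecDepth 20000 in
set_option synthInstance.maxSize 2000 in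
set_option synthInstance.maxHeartbeats 400000 in
theorem armchair_tw : ∀ i j, (∀ k, armchair.Adj i k ↔ armchair.Adj j k) → i = j := by
  simp only [armchair, SimpleGraph.fromRel_adj]; decide

set_option maxRecDepth 20000 in
set_option synthInstance.maxSize 2000 in
set_option synthInstance.maxHeartbeats 400000 in
theorem stirrer_tw : ∀ i j, (∀ k, stirrer.Adj i k ↔ stirrer.Adj j k) → i = j := by
  simp only [stirrer, SimpleGraph.fromRel_adj]; decide

set_option maxRecDepth 20000 in
set_option synthInstance.maxSize 2000 in
set_option synthInstance.maxHeartbeats 400000 in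
theorem tripod_tw : ∀ i j, (∀ k, tripod.Adj i k ↔ tripod.Adj j k) → i = j := by
  simp only [tripod, SimpleGraph.fromRel_adj]; decide


open Classical

/-- Elementwise version of the graph class. -/
structure Cls {V : Type*} (d : ℕ) (G : SimpleGraph V) : Prop where
  bip : ∃ χ : V → Bool, ∀ u v, G.Adj u v → χ u ≠ χ v
  arm : ∀ c1 c3 p2 c2 c4 p1 p3, G.Adj c1 c2 → G.Adj c1 c4 → G.Adj c1 p1 → ¬ G.Adj c1 p3 →
    G.Adj c3 c2 → G.Adj c3 c4 → ¬ G.Adj c3 p1 → G.Adj c3 p3 →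
    G.Adj p2 c2 → ¬ G.Adj p2 c4 → ¬ G.Adj p2 p1 → ¬ G.Adj p2 p3 → False
  stir : ∀ v0 v2 v4 v1 v3 v5 v6, G.Adj v0 v1 → G.Adj v0 v3 → G.Adj v0 v5 → G.Adj v0 v6 →
    G.Adj v2 v1 → G.Adj v2 v3 → ¬ G.Adj v2 v5 → ¬ G.Adj v2 v6 →
    G.Adj v4 v1 → ¬ G.Adj v4 v3 → G.Adj v4 v5 → ¬ G.Adj v4 v6 → False
  tri : ∀ v0 v2 v4 v6 v1 v3 v5, G.Adj v0 v1 → G.Adj v0 v3 → G.Adj v0 v5 →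
    G.Adj v2 v1 → ¬ G.Adj v2 v3 → ¬ G.Adj v2 v5 →
    ¬ G.Adj v4 v1 → G.Adj v4 v3 → ¬ G.Adj v4 v5 →
    ¬ G.Adj v6 v1 → ¬ G.Adj v6 v3 → G.Adj v6 v5 → False
  K : ∀ P Q : Finset V, (∀ p ∈ P, ∀ q ∈ Q, G.Adj p q) → d + 1 ≤ P.card → d + 1 ≤ Q.card → False

/-- The bag of `v` in the layout `f`. -/
def bagS {V : Type*} (G : SimpleGraph V) (f : V → ℕ) (v : V) : Set V :=
  {x | x = v ∨ (f x < f v ∧ ∃ y, G.Adj x y ∧ f v ≤ f y)}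

/-- `G` has a layout with all bags of size at most `k`. -/
def Lay {V : Type*} (G : SimpleGraph V) (k : ℕ) : Prop :=
  ∃ f : V → ℕ, Function.Injective f ∧ ∀ v, (bagS G f v).ncard ≤ k

/-- No induced cycle of length at least six: a vertex `p` and an induced path `r 0, ..., r k`. -/
def HoleFr {V : Type*} (G : SimpleGraph V) : Prop :=
  ∀ (p : V) (k : ℕ) (r : ℕ → V), 4 ≤ k →
    (∀ i j, i ≤ k → j ≤ k → (G.Adj (r i) (r j) ↔ i + 1 = j ∨ j + 1 = i)) →
    (∀ i, i ≤ k → (G.Adj p (r i) ↔ i = 0 ∨ i = k)) → False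

theorem HoleFr.induce {V : Type*} {G : SimpleGraph V} (h : HoleFr G) (s : Set V) :
    HoleFr (G.induce s) := by
  intro p k r hk h1 h2
  exact h p k (fun i => r i) hk (fun i j hi hj => by simpa using h1 i j hi hj)
    (fun i hi => by simpa using h2 i hi)

theorem Cls.induce {V : Type*} {d : ℕ} {G : SimpleGraph V} (h : Cls d G) (s : Set V) :
    Cls d (G.induce s) := by
  obtain ⟨χ, hχ⟩ := h.bip
  refine ⟨⟨fun x => χ x, fun u v huv => hχ _ _ huv⟩, ?_, ?_, ?_, ?_⟩
  · intro c1 c3 p2 c2 c4 p1 p3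
    exact h.arm c1 c3 p2 c2 c4 p1 p3
  · intro c1 c3 p2 c2 c4 p1 p3
    exact h.stir c1 c3 p2 c2 c4 p1 p3
  · intro c1 c3 p2 c2 c4 p1 p3
    exact h.tri c1 c3 p2 c2 c4 p1 p3
  · intro P Q hPQ hP hQ
    refine h.K (P.map (Function.Embedding.subtype _)) (Q.map (Function.Embedding.subtype _)) ?_ ?_ ?_
    · intro p hp q hq
      simp only [Finset.mem_map, Function.Embedding.coe_subtype] at hp hq
      obtain ⟨p, hp, rfl⟩ := hp
      obtain ⟨q, hq, rfl⟩ := hq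
      exact hPQ p hp q hq
    · simpa using hP
    · simpa using hQ

theorem Lay.pathwidth_le {V : Type*} [Fintype V] {G : SimpleGraph V} {k : ℕ} (h : Lay G k) :
    pathwidth G ≤ k - 1 := by
  obtain ⟨f, hf, hb⟩ := h
  set N := Finset.univ.sup f + 1 with hN
  have hfN : ∀ x, f x < N := fun x => Nat.lt_succ_of_le (Finset.le_sup (Finset.mem_univ x))
  let D : PathDecomp G :=
    { len := N
      len_pos := by omega
      bags := fun t => Finset.univ.filter fun x =>
        f x = t ∨ (f x < t ∧ ∃ y, G.Adj x y ∧ (t : ℕ) ≤ f y)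
      mem_bag := fun v => ⟨⟨f v, hfN v⟩, by simp⟩
      edge_bag := by
        intro u v huv
        rcases lt_trichotomy (f u) (f v) with h | h | h
        · exact ⟨⟨f v, hfN v⟩, by simp; exact Or.inr ⟨h, v, huv, le_rfl⟩, by simp⟩
        · exact absurd (hf h) huv.ne
        · exact ⟨⟨f u, hfN u⟩, by simp, by simp; exact Or.inr ⟨h, u, huv.symm, le_rfl⟩⟩
      interval := by
        intro v i j l hij hjl hi hl
        have hij' : (i : ℕ) ≤ j := hij
        have hjl' : (j : ℕ) ≤ l := hjl
        simp only [Finset.mem_filter, Finset.mem_univ, true_and] at hi hl ⊢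
        have h1 : f v ≤ i := by rcases hi with h | h <;> omega
        rcases hl with h | ⟨h, y, hy, hly⟩
        · left; omega
        · by_cases hv : f v = j
          · exact Or.inl hv
          · exact Or.inr ⟨by omega, y, hy, by omega⟩ }
  have hD : D.width ≤ k - 1 := by
    unfold PathDecomp.width
    apply Nat.sub_le_sub_right
    apply Finset.sup_le
    intro t _
    change (Finset.univ.filter fun x =>
        f x = t ∨ (f x < t ∧ ∃ y, G.Adj x y ∧ (t : ℕ) ≤ f y)).card ≤ k
    by_cases hex : ∃ y, (t : ℕ) ≤ f y
    · obtain ⟨v, hv, hmin⟩ := (Finset.univ.filter fun y => (t : ℕ) ≤ f y).exists_min_image f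
        (by obtain ⟨y, hy⟩ := hex; exact ⟨y, by simpa using hy⟩)
      simp only [Finset.mem_filter, Finset.mem_univ, true_and] at hv hmin
      refine le_trans ?_ (hb v)
      rw [← Set.ncard_coe_finset]
      apply Set.ncard_le_ncard _ (Set.toFinite _)
      intro x hx
      simp only [Finset.coe_filter, Finset.mem_univ, true_and, Set.mem_setOf_eq] at hx
      rcases hx with hx | ⟨hx, y, hxy, hy⟩
      · left
        apply hf
        have := hmin x hx.ge
        omega
      · right
        exact ⟨by omega, y, hxy, hmin y hy⟩
    · have : (Finset.univ.filter fun x =>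
        f x = t ∨ (f x < t ∧ ∃ y, G.Adj x y ∧ (t : ℕ) ≤ f y)) = ∅ := by
        apply Finset.filter_eq_empty_iff.2
        rintro x - (hx | ⟨-, y, -, hy⟩)
        · exact hex ⟨x, hx.ge⟩
        · exact hex ⟨y, hy⟩
      rw [this]; simp
  exact le_trans (Nat.sInf_le ⟨D, rfl⟩) hD

theorem Lay.mono {V : Type*} {G : SimpleGraph V} {k l : ℕ} (h : Lay G k) (hkl : k ≤ l) :
    Lay G l := by
  obtain ⟨f, hf, hb⟩ := h
  exact ⟨f, hf, fun v => (hb v).trans hkl⟩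

theorem Lay.split {V : Type*} [Fintype V] {G : SimpleGraph V} {k : ℕ} (s : Set V)
    (hs : ∀ x ∈ s, ∀ y ∉ s, ¬ G.Adj x y) (h1 : Lay (G.induce s) k)
    (h2 : Lay (G.induce sᶜ) k) : Lay G k := by
  obtain ⟨f, hf, hfb⟩ := h1
  obtain ⟨g, hg, hgb⟩ := h2
  set N := Finset.univ.sup f + 1 with hN
  have hfN : ∀ x, f x < N := fun x => Nat.lt_succ_of_le (Finset.le_sup (Finset.mem_univ x))
  let F : V → ℕ := fun x => if hx : x ∈ s then f ⟨x, hx⟩ else N + g ⟨x, hx⟩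
  have F1 : ∀ x (hx : x ∈ s), F x = f ⟨x, hx⟩ := fun x hx => by simp [F, hx]
  have F2 : ∀ x (hx : x ∉ s), F x = N + g ⟨x, hx⟩ := fun x hx => by simp [F, hx]
  refine ⟨F, ?_, ?_⟩
  · intro x y hxy
    by_cases hx : x ∈ s <;> by_cases hy : y ∈ s
    · rw [F1 x hx, F1 y hy] at hxy
      simpa using hf hxy
    · rw [F1 x hx, F2 y hy] at hxy
      have := hfN ⟨x, hx⟩; omega
    · rw [F2 x hx, F1 y hy] at hxy
      have := hfN ⟨y, hy⟩; omega
    · rw [F2 x hx, F2 y hy] at hxy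
      simpa using hg (Nat.add_left_cancel hxy)
  · intro v
    by_cases hv : v ∈ s
    · refine le_trans ?_ (hfb ⟨v, hv⟩)
      rw [← Set.ncard_image_of_injective _ Subtype.val_injective]
      apply Set.ncard_le_ncard _ (Set.toFinite _)
      rintro x (rfl | ⟨hx, y, hxy, hy⟩)
      · exact ⟨⟨x, hv⟩, Or.inl rfl, rfl⟩
      · by_cases hxs : x ∈ s
        · have hys : y ∈ s := by
            by_contra hys
            exact hs x hxs y hys hxy
          rw [F1 x hxs, F1 v hv] at hx
          rw [F1 y hys, F1 v hv] at hy
          exact ⟨⟨x, hxs⟩, Or.inr ⟨hx, ⟨y, hys⟩, hxy, hy⟩, rfl⟩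
        · rw [F1 v hv, F2 x hxs] at hx
          have := hfN ⟨v, hv⟩; omega
    · refine le_trans ?_ (hgb ⟨v, hv⟩)
      rw [← Set.ncard_image_of_injective _ Subtype.val_injective]
      apply Set.ncard_le_ncard _ (Set.toFinite _)
      rintro x (rfl | ⟨hx, y, hxy, hy⟩)
      · exact ⟨⟨x, hv⟩, Or.inl rfl, rfl⟩
      · by_cases hys : y ∈ s
        · rw [F1 y hys, F2 v hv] at hy
          have := hfN ⟨y, hys⟩; omega
        · have hxs : x ∉ s := fun hxs => hs x hxs y hys hxy
          rw [F2 x hxs, F2 v hv] at hx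
          rw [F2 y hys, F2 v hv] at hy
          exact ⟨⟨x, hxs⟩, Or.inr ⟨by omega, ⟨y, hys⟩, hxy, by omega⟩, rfl⟩

theorem Lay.delete {V : Type*} [Fintype V] {G : SimpleGraph V} {k m : ℕ} (s : Set V)
    (hs : s.ncard ≤ m) (h2 : Lay (G.induce sᶜ) k) : Lay G (m + k) := by
  obtain ⟨g, hg, hgb⟩ := h2
  let f : s → ℕ := fun x => (Fintype.equivFin s x : ℕ)
  have hf : Function.Injective f := fun x y h => (Fintype.equivFin s).injective (Fin.ext h)
  set N := Finset.univ.sup f + 1 with hN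
  have hfN : ∀ x, f x < N := fun x => Nat.lt_succ_of_le (Finset.le_sup (Finset.mem_univ x))
  let F : V → ℕ := fun x => if hx : x ∈ s then f ⟨x, hx⟩ else N + g ⟨x, hx⟩
  have F1 : ∀ x (hx : x ∈ s), F x = f ⟨x, hx⟩ := fun x hx => by simp [F, hx]
  have F2 : ∀ x (hx : x ∉ s), F x = N + g ⟨x, hx⟩ := fun x hx => by simp [F, hx]
  refine ⟨F, ?_, ?_⟩
  · intro x y hxy
    by_cases hx : x ∈ s <;> by_cases hy : y ∈ s
    · rw [F1 x hx, F1 y hy] at hxy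
      simpa using hf hxy
    · rw [F1 x hx, F2 y hy] at hxy
      have := hfN ⟨x, hx⟩; omega
    · rw [F2 x hx, F1 y hy] at hxy
      have := hfN ⟨y, hy⟩; omega
    · rw [F2 x hx, F2 y hy] at hxy
      simpa using hg (Nat.add_left_cancel hxy)
  · intro v
    by_cases hv : v ∈ s
    · refine le_trans ?_ (hs.trans (Nat.le_add_right m k))
      apply Set.ncard_le_ncard _ (Set.toFinite _)
      rintro x (rfl | ⟨hx, -⟩)
      · exact hv
      · by_contra hxs
        rw [F1 v hv, F2 x hxs] at hx
        have := hfN ⟨v, hv⟩; omega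
    · have hsub : bagS G F v ⊆ s ∪ Subtype.val '' bagS (G.induce sᶜ) g ⟨v, hv⟩ := by
        rintro x (rfl | ⟨hx, y, hxy, hy⟩)
        · exact Or.inr ⟨⟨x, hv⟩, Or.inl rfl, rfl⟩
        · by_cases hxs : x ∈ s
          · exact Or.inl hxs
          · have hys : y ∉ s := by
              intro hys
              rw [F1 y hys, F2 v hv] at hy
              have := hfN ⟨y, hys⟩; omega
            rw [F2 x hxs, F2 v hv] at hx
            rw [F2 y hys, F2 v hv] at hy
            exact Or.inr ⟨⟨x, hxs⟩, Or.inr ⟨by omega, ⟨y, hys⟩, hxy, by omega⟩, rfl⟩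
      refine (Set.ncard_le_ncard hsub (Set.toFinite _)).trans ((Set.ncard_union_le _ _).trans ?_)
      rw [Set.ncard_image_of_injective _ Subtype.val_injective]
      exact Nat.add_le_add hs (hgb _)

theorem card_initial_le {V : Type*} [Fintype V] (g : V → ℕ) (hg : Function.Injective g)
    (S : Finset V) (d : ℕ) :
    (S.filter fun a => (S.filter fun a' => g a' < g a).card < d).card ≤ d := by
  set E := S.filter fun a => (S.filter fun a' => g a' < g a).card < d with hE
  by_cases hne : E.Nonempty
  · obtain ⟨m, hm, hmax⟩ := E.exists_max_image g hne
    have h1 : (S.filter fun a' => g a' < g m).card < d := by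
      rw [hE, Finset.mem_filter] at hm; exact hm.2
    have h2 : E.erase m ⊆ S.filter fun a' => g a' < g m := by
      intro x hx
      rw [Finset.mem_erase] at hx
      rw [Finset.mem_filter]
      refine ⟨(Finset.mem_filter.1 hx.2).1, lt_of_le_of_ne (hmax x hx.2) ?_⟩
      intro h; exact hx.1 (hg h)
    have h3 := Finset.card_le_card h2
    rw [Finset.card_erase_of_mem hm] at h3
    omega
  · rw [Finset.not_nonempty_iff_eq_empty] at hne
    rw [hne]; simp

theorem lay_of_order {V : Type*} [Fintype V] {G : SimpleGraph V} {d : ℕ} (hd : 1 ≤ d)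
    (χ : V → Bool) (hχ : ∀ u v, G.Adj u v → χ u ≠ χ v) (g : V → ℕ) (hg : Function.Injective g)
    (hSO : ∀ a a' b b', g a ≤ g a' → g b ≤ g b' → G.Adj a b' → G.Adj a' b → χ a = χ a' →
      G.Adj a b ∧ G.Adj a' b')
    (hiso : ∀ x, ∃ y, G.Adj x y)
    (hK : ∀ P Q : Finset V, (∀ p ∈ P, ∀ q ∈ Q, G.Adj p q) → d + 1 ≤ P.card → d + 1 ≤ Q.card →
      False) : Lay G (2 * d) := by
  -- interval property
  have IP : ∀ p b' b b'', G.Adj p b' → G.Adj p b'' → g b' ≤ g b → g b ≤ g b'' → χ b = χ b' →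
      G.Adj p b := by
    intro p b' b b'' h1 h2 h3 h4 h5
    obtain ⟨s, hs⟩ := hiso b
    have hc : χ s = χ p := by
      have e1 := hχ _ _ h1
      have e2 := hχ _ _ hs
      revert e1 e2 h5
      cases χ s <;> cases χ p <;> cases χ b <;> cases χ b' <;> simp
    rcases le_total (g p) (g s) with h | h
    · exact (hSO p s b b'' h h4 h2 hs.symm hc.symm).1
    · exact (hSO s p b' b h h3 hs.symm h1 hc).2
  set N := Finset.univ.sup g + 1 with hN
  have hgN : ∀ x, g x < N := fun x => Nat.lt_succ_of_le (Finset.le_sup (Finset.mem_univ x))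
  let α : V → Finset V := fun b => Finset.univ.filter fun a =>
    χ a = true ∧ ∃ y, G.Adj a y ∧ g b ≤ g y
  have hα : ∀ b a, a ∈ α b ↔ χ a = true ∧ ∃ y, G.Adj a y ∧ g b ≤ g y := by
    intro b a; simp [α]
  have hαmono : ∀ b b', g b ≤ g b' → α b' ⊆ α b := by
    intro b b' h x hx
    rw [hα] at hx ⊢
    obtain ⟨h1, y, h2, h3⟩ := hx
    exact ⟨h1, y, h2, h.trans h3⟩
  let cnt : V → ℕ → ℕ := fun b m => ((α b).filter fun a => g a < m).card
  have cnt_mono : ∀ b m m', m ≤ m' → cnt b m ≤ cnt b m' := by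
    intro b m m' h
    apply Finset.card_le_card
    intro x hx
    rw [Finset.mem_filter] at hx ⊢
    exact ⟨hx.1, by omega⟩
  have cnt_anti : ∀ b b' m, g b ≤ g b' → cnt b' m ≤ cnt b m := by
    intro b b' m h
    apply Finset.card_le_card
    exact Finset.filter_subset_filter _ (hαmono b b' h)
  let τ : V → ℕ := fun b => Nat.findGreatest (fun m => cnt b m < d) N + 1
  have hτ : ∀ b a, g a < τ b ↔ cnt b (g a) < d := by
    intro b a
    constructor
    · intro h
      have h0 : cnt b (Nat.findGreatest (fun m => cnt b m < d) N) < d := by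
        apply Nat.findGreatest_spec (P := fun m => cnt b m < d) (Nat.zero_le N)
        simp [cnt]; omega
      exact lt_of_le_of_lt (cnt_mono b _ _ (Nat.lt_succ_iff.1 h)) h0
    · intro h
      exact Nat.lt_succ_iff.2 (Nat.le_findGreatest (hgN a).le h)
  have hτmono : ∀ b b', g b ≤ g b' → τ b ≤ τ b' := by
    intro b b' h
    apply Nat.succ_le_succ
    apply Nat.findGreatest_mono_left
    intro m hm
    exact lt_of_le_of_lt (cnt_anti b b' m h) hm
  let f : V → ℕ := fun x => if χ x = true then (N + 2) * g x + (N + 1) else (N + 2) * τ x + g x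
  have fA : ∀ x, χ x = true → f x = (N + 2) * g x + (N + 1) := fun x hx => by simp [f, hx]
  have fB : ∀ x, χ x = false → f x = (N + 2) * τ x + g x := fun x hx => by simp [f, hx]
  have mulmono : ∀ m n, m + 1 ≤ n → (N + 2) * m + (N + 2) ≤ (N + 2) * n := by
    intro m n h
    have := Nat.mul_le_mul_left (N + 2) h
    linarith
  have oAA : ∀ a a', χ a = true → χ a' = true → (f a < f a' ↔ g a < g a') := by
    intro a a' h h'
    rw [fA a h, fA a' h']
    constructor
    · intro h1
      by_contra h2
      have := Nat.mul_le_mul_left (N + 2) (not_lt.1 h2)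
      omega
    · intro h1
      have := mulmono _ _ h1
      omega
  have oBB : ∀ a a', χ a = false → χ a' = false → (g a < g a' → f a < f a') := by
    intro a a' h h' h1
    rw [fB a h, fB a' h']
    have := Nat.mul_le_mul_left (N + 2) (hτmono a a' h1.le)
    omega
  have oBB' : ∀ a a', χ a = false → χ a' = false → (f a < f a' ↔ g a < g a') := by
    intro a a' h h'
    refine ⟨fun h1 => ?_, oBB a a' h h'⟩
    by_contra h2
    rcases (not_lt.1 h2).lt_or_eq with h3 | h3
    · have := oBB a' a h' h h3; omega
    · rw [hg h3] at h1; omega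
  have oAB : ∀ a b, χ a = true → χ b = false → cnt b (g a) < d → f a < f b := by
    intro a b h h' h1
    rw [fA a h, fB b h']
    have := mulmono _ _ ((hτ b a).2 h1)
    omega
  have oBA : ∀ a b, χ a = true → χ b = false → ¬ cnt b (g a) < d → f b < f a := by
    intro a b h h' h1
    rw [fA a h, fB b h']
    rw [← hτ] at h1
    have := Nat.mul_le_mul_left (N + 2) (not_lt.1 h1)
    have := hgN b
    omega
  have oAB' : ∀ a b, χ a = true → χ b = false → f a ≤ f b → cnt b (g a) < d := by
    intro a b h h' h1
    by_contra h2
    have := oBA a b h h' h2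
    omega
  have oBA' : ∀ a b, χ a = true → χ b = false → f b ≤ f a → d ≤ cnt b (g a) := by
    intro a b h h' h1
    by_contra h2
    have := oAB a b h h' (by omega)
    omega
  have finj : Function.Injective f := by
    intro x y hxy
    cases hx : χ x <;> cases hy : χ y
    · apply hg
      have h1 := oBB' x y hx hy
      have h2 := oBB' y x hy hx
      omega
    · have h1 := oBA' y x hy hx hxy.le
      have h2 := oAB' y x hy hx hxy.ge
      omega
    · have h1 := oBA' x y hx hy hxy.ge
      have h2 := oAB' x y hx hy hxy.le
      omega
    · apply hg
      have h1 := oAA x y hx hy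
      have h2 := oAA y x hy hx
      omega
  refine ⟨f, finj, ?_⟩
  intro v
  have key : ∀ A' B' : Finset V, A'.card ≤ d → B'.card ≤ d →
      (∀ x ∈ bagS G f v, χ x = true → x ∈ A') → (∀ x ∈ bagS G f v, χ x = false → x ∈ B') →
      (bagS G f v).ncard ≤ 2 * d := by
    intro A' B' hA hB h1 h2
    have : bagS G f v ⊆ ((A' ∪ B' : Finset V) : Set V) := by
      intro x hx
      rw [Finset.mem_coe, Finset.mem_union]
      cases hc : χ x
      · exact Or.inr (h2 x hx hc)
      · exact Or.inl (h1 x hx hc)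
    have h3 := Set.ncard_le_ncard this (Set.toFinite _)
    rw [Set.ncard_coe_finset] at h3
    have := Finset.card_union_le A' B'
    omega
  have nt : ∀ x y, G.Adj x y → χ x = true → χ y = false := by
    intro x y h h1
    have := hχ _ _ h
    revert this; rw [h1]; cases χ y <;> simp
  have nf : ∀ x y, G.Adj x y → χ x = false → χ y = true := by
    intro x y h h1
    have := hχ _ _ h
    revert this; rw [h1]; cases χ y <;> simp
  cases hv : χ v
  · -- v on the B side
    apply key ((α v).filter fun a => ((α v).filter fun a' => g a' < g a).card < d)
      (Finset.univ.filter fun x => x ∈ bagS G f v ∧ χ x = false)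
    · exact card_initial_le g hg _ d
    · set Q := Finset.univ.filter fun x => x ∈ bagS G f v ∧ χ x = false with hQ
      let Y := Finset.univ.filter fun y => χ y = true ∧ f v < f y ∧ ∃ b, G.Adj b y ∧ g b < g v
      by_cases hY : Y.Nonempty
      · obtain ⟨s, hs, hmin⟩ := Y.exists_min_image g hY
        simp only [Y, Finset.mem_filter, Finset.mem_univ, true_and] at hs hmin
        obtain ⟨hs1, hs2, b0, hb0, hb0v⟩ := hs
        by_contra hcard
        have hPc := oBA' s v hs1 hv hs2.le
        set P := (α v).filter fun a => g a < g s with hP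
        have hsP : s ∉ P := by rw [hP, Finset.mem_filter]; simp
        refine hK (insert s P) Q ?_ (by rw [Finset.card_insert_of_notMem hsP]; change d ≤ P.card at hPc; omega) (by omega)
        have hQ' : ∀ q ∈ Q, q = v ∨ (g q < g v ∧ χ q = false ∧ ∃ y, G.Adj q y ∧ g s ≤ g y ∧ χ y = true) := by
          intro q hq
          simp only [hQ, Finset.mem_filter, Finset.mem_univ, true_and] at hq
          obtain ⟨hq | ⟨h1, y, h2, h3⟩, hq2⟩ := hq
          · exact Or.inl hq
          · right
            have hy := nf _ _ h2 hq2
            have hne : f v ≠ f y := by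
              intro h; rw [finj h, hy] at hv; simp at hv
            have hqv := (oBB' q v hq2 hv).1 h1
            exact ⟨hqv, hq2, y, h2, hmin y ⟨hy, by omega, q, h2, hqv⟩, hy⟩
        have pq : ∀ p ∈ P, ∀ y b, G.Adj b y → g s ≤ g y → g b < g v → χ y = true →
            G.Adj p b ∧ ∃ bp, g v ≤ g bp ∧ G.Adj p bp ∧ G.Adj y bp := by
          intro p hp y b h1 h2 h3 h4
          rw [hP, Finset.mem_filter, hα] at hp
          obtain ⟨⟨hp1, bp, hp2, hp3⟩, hp4⟩ := hp
          have := hSO p y b bp (by omega) (by omega) hp2 h1.symm (by rw [hp1, h4])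
          exact ⟨this.1, bp, hp3, hp2, this.2⟩
        have hPne : ∃ p, p ∈ P := Finset.card_pos.1 (by change d ≤ P.card at hPc; omega)
        have hχ0 : χ v = χ b0 := by
          have := hχ _ _ hb0
          rw [hs1] at this; rw [hv]; revert this; cases χ b0 <;> simp
        intro p hp q hq
        rw [Finset.mem_insert] at hp
        rcases hp with rfl | hp
        · rcases hQ' q hq with rfl | ⟨h1, h2, y, h3, h4, h5⟩
          · obtain ⟨p', hp'⟩ := hPne
            obtain ⟨-, bp, h1, h2, h3⟩ := pq p' hp' p b0 hb0 le_rfl hb0v hs1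
            exact IP p b0 q bp hb0.symm h3 hb0v.le h1 hχ0
          · obtain ⟨p', hp'⟩ := hPne
            have := (pq p' hp' y q h3 h4 h1 h5).1
            rw [hP, Finset.mem_filter, hα] at hp'
            exact (IP q p' p y this.symm h3 hp'.2.le h4 (by rw [hs1, hp'.1.1])).symm
        · rcases hQ' q hq with rfl | ⟨h1, h2, y, h3, h4, h5⟩
          · obtain ⟨h0, bp, h1, h2, h3⟩ := pq p hp s b0 hb0 le_rfl hb0v hs1
            exact IP p b0 q bp h0 h2 hb0v.le h1 hχ0
          · exact (pq p hp y q h3 h4 h1 h5).1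
      · have : Q ⊆ {v} := by
          intro q hq
          simp only [hQ, Finset.mem_filter, Finset.mem_univ, true_and] at hq
          obtain ⟨hq | ⟨h1, y, h2, h3⟩, hq2⟩ := hq
          · simp [hq]
          · exfalso
            apply hY
            have hy := nf _ _ h2 hq2
            have hne : f v ≠ f y := by
              intro h; rw [finj h, hy] at hv; simp at hv
            have hqv := (oBB' q v hq2 hv).1 h1
            exact ⟨y, by
              simp only [Y, Finset.mem_filter, Finset.mem_univ, true_and]
              exact ⟨hy, by omega, q, h2, hqv⟩⟩
        have := Finset.card_le_card this
        simp at this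
        omega
    · rintro x (rfl | ⟨h1, y, h2, h3⟩) hx
      · rw [hv] at hx; simp at hx
      · rw [Finset.mem_filter, hα]
        have hy := nt _ _ h2 hx
        refine ⟨⟨hx, y, h2, ?_⟩, oAB' x v hx hv h1.le⟩
        have := oBB' y v hy hv
        omega
    · intro x hx hx2
      simp [hx, hx2]
  · -- v on the A side
    apply key (Finset.univ.filter fun x => x ∈ bagS G f v ∧ χ x = true)
      (Finset.univ.filter fun x => x ∈ bagS G f v ∧ χ x = false)
    · set E := Finset.univ.filter fun x => x ∈ bagS G f v ∧ χ x = true with hE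
      let Y := Finset.univ.filter fun y => χ y = false ∧ f v ≤ f y
      by_cases hY : Y.Nonempty
      · obtain ⟨s, hs, hmin⟩ := Y.exists_min_image g hY
        simp only [Y, Finset.mem_filter, Finset.mem_univ, true_and] at hs hmin
        have hc := oAB' v s hv hs.1 hs.2
        have : E ⊆ insert v ((α s).filter fun a => g a < g v) := by
          intro x hx
          simp only [hE, Finset.mem_filter, Finset.mem_univ, true_and] at hx
          obtain ⟨hx | ⟨h1, y, h2, h3⟩, hx2⟩ := hx
          · simp [hx]
          · rw [Finset.mem_insert, Finset.mem_filter, hα]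
            right
            exact ⟨⟨hx2, y, h2, hmin y ⟨nt _ _ h2 hx2, h3⟩⟩, (oAA x v hx2 hv).1 h1⟩
        have h1 := Finset.card_le_card this
        have h2 := Finset.card_insert_le v ((α s).filter fun a => g a < g v)
        change ((α s).filter fun a => g a < g v).card < d at hc
        omega
      · have : E ⊆ {v} := by
          intro x hx
          simp only [hE, Finset.mem_filter, Finset.mem_univ, true_and] at hx
          obtain ⟨hx | ⟨h1, y, h2, h3⟩, hx2⟩ := hx
          · simp [hx]
          · exfalso
            apply hY
            exact ⟨y, by
              simp only [Y, Finset.mem_filter, Finset.mem_univ, true_and]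
              exact ⟨nt _ _ h2 hx2, h3⟩⟩
        have := Finset.card_le_card this
        simp at this
        omega
    · set R := Finset.univ.filter fun x => x ∈ bagS G f v ∧ χ x = false with hR
      have hR' : ∀ q ∈ R, χ q = false ∧ f q < f v ∧ ∃ y, G.Adj q y ∧ g v ≤ g y ∧ χ y = true := by
        intro q hq
        simp only [hR, Finset.mem_filter, Finset.mem_univ, true_and] at hq
        obtain ⟨hq | ⟨h1, y, h2, h3⟩, hq2⟩ := hq
        · rw [hq, hv] at hq2; simp at hq2
        · have hy := nf _ _ h2 hq2
          refine ⟨hq2, h1, y, h2, ?_, hy⟩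
          have := oAA y v hy hv
          omega
      by_cases hne : R.Nonempty
      · obtain ⟨s, hs, hmax⟩ := R.exists_max_image g hne
        by_contra hcard
        obtain ⟨hs1, hs2, -⟩ := hR' s hs
        have hPc := oBA' v s hv hs1 hs2.le
        set P := (α s).filter fun a => g a < g v with hP
        have hsP : v ∉ P := by rw [hP, Finset.mem_filter]; simp
        have pq : ∀ p ∈ P, ∀ q ∈ R, G.Adj p q := by
          intro p hp q hq
          obtain ⟨hq1, hq2, y, hq3, hq4, hq5⟩ := hR' q hq
          rw [hP, Finset.mem_filter, hα] at hp
          obtain ⟨⟨hp1, bp, hp2, hp3⟩, hp4⟩ := hp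
          exact (hSO p y q bp (by omega) ((hmax q hq).trans hp3) hp2 hq3.symm (by rw [hp1, hq5])).1
        refine hK (insert v P) R ?_ (by rw [Finset.card_insert_of_notMem hsP]; change d ≤ P.card at hPc; omega) (by omega)
        obtain ⟨p', hp'⟩ : ∃ p, p ∈ P := Finset.card_pos.1 (by change d ≤ P.card at hPc; omega)
        intro p hp q hq
        rw [Finset.mem_insert] at hp
        rcases hp with rfl | hp
        · obtain ⟨hq1, hq2, y, hq3, hq4, hq5⟩ := hR' q hq
          have h1 := pq p' hp' q hq
          rw [hP, Finset.mem_filter, hα] at hp'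
          exact (IP q p' p y h1.symm hq3 hp'.2.le hq4 (by rw [hv, hp'.1.1])).symm
        · exact pq p hp q hq
      · rw [Finset.not_nonempty_iff_eq_empty] at hne
        rw [hne]; simp
    · intro x hx hx2
      simp [hx, hx2]
    · intro x hx hx2
      simp [hx, hx2]

/-- Chain lemma. -/
theorem chain_pick {V : Type*} (M : Finset V) (F : Finset (Finset V)) (k : ℕ)
    (hk : k < M.card) (hsub : ∀ C ∈ F, C ⊆ M) (hch : ∀ C ∈ F, ∀ C' ∈ F, C ⊆ C' ∨ C' ⊆ C) :
    ∃ M' ⊆ M, M'.card = k ∧ ∃ b ∈ M, b ∉ M' ∧ ∀ C ∈ F, b ∉ C → C ⊆ M' := by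
  have hch' : ∀ C ∈ insert ∅ (insert M F), ∀ C' ∈ insert ∅ (insert M F), C ⊆ C' ∨ C' ⊆ C := by
    intro C hC C' hC'
    simp only [Finset.mem_insert] at hC hC'
    rcases hC with rfl | rfl | hC
    · left; simp
    · rcases hC' with rfl | rfl | hC'
      · right; simp
      · left; simp
      · right; exact hsub _ hC'
    · rcases hC' with rfl | rfl | hC'
      · right; simp
      · left; exact hsub _ hC
      · exact hch _ hC _ hC'
  have hle : ∀ C ∈ insert ∅ (insert M F), ∀ C' ∈ insert ∅ (insert M F), C.card ≤ C'.card → C ⊆ C' := by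
    intro C hC C' hC' h
    rcases hch' C hC C' hC' with h1 | h1
    · exact h1
    · rw [Finset.eq_of_subset_of_card_le h1 h]
  obtain ⟨C1, hC1, hmax⟩ := Finset.exists_max_image ((insert ∅ (insert M F)).filter (fun C => C.card ≤ k))
    Finset.card ⟨∅, by simp⟩
  obtain ⟨C2, hC2, hmin⟩ := Finset.exists_min_image ((insert ∅ (insert M F)).filter (fun C => k < C.card))
    Finset.card ⟨M, by simp [hk]⟩
  rw [Finset.mem_filter] at hC1 hC2
  obtain ⟨M', h1, h2, h3⟩ := Finset.exists_subsuperset_card_eq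
    (hle C1 hC1.1 C2 hC2.1 (by omega)) hC1.2 (le_of_lt hC2.2)
  have hC2M : C2 ⊆ M := by
    have := hC2.1
    simp only [Finset.mem_insert] at this
    rcases this with rfl | rfl | h
    · simp
    · simp
    · exact hsub _ h
  obtain ⟨b, hb, hb'⟩ := Finset.exists_mem_notMem_of_card_lt_card (s := M') (t := C2) (by omega)
  refine ⟨M', h2.trans hC2M, h3, b, hC2M hb, hb', ?_⟩
  intro C hC hbC
  have hCi : C ∈ insert ∅ (insert M F) := by simp [hC]
  by_cases hc : C.card ≤ k
  · exact (hle C hCi C1 hC1.1 (hmax C (by simp [hC, hc]))).trans h1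
  · exfalso
    exact hbC (hle C2 hC2.1 C hCi (hmin C (by rw [Finset.mem_filter]; exact ⟨hCi, by omega⟩)) hb)

theorem Cls.final_biclique {V : Type*} [Fintype V] {d : ℕ} {G : SimpleGraph V} (h : Cls d G)
    (hdeg : ∀ v, 2 * d + 1 ≤ (Finset.univ.filter (G.Adj v)).card)
    (N S : Finset V) (b : V) (hb : b ∈ N) (hbS : b ∉ S) (hSN : S ⊆ N)
    (h1 : d ≤ S.card) (h2 : S.card + d + 1 ≤ N.card)
    (hcase : ∀ a, G.Adj a b → (∀ x ∈ N, ¬ G.Adj a x → x ∈ S) ∨ (∀ x ∈ N, ¬ G.Adj a x → x ∉ S)) :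
    False := by
  set A := Finset.univ.filter (G.Adj b) with hA
  have hAc := hdeg b
  rw [← hA] at hAc
  set A1 := A.filter (fun a => ∀ x ∈ N, ¬ G.Adj a x → x ∈ S) with hA1
  set A2 := A.filter (fun a => ¬ ∀ x ∈ N, ¬ G.Adj a x → x ∈ S) with hA2
  have hsum : A1.card + A2.card = A.card := Finset.card_filter_add_card_filter_not _
  by_cases hc : d + 1 ≤ A1.card
  · refine h.K A1 (N \ S) ?_ hc ?_
    · intro p hp q hq
      rw [hA1, Finset.mem_filter] at hp
      rw [Finset.mem_sdiff] at hq
      by_contra hn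
      exact hq.2 (hp.2 q hq.1 hn)
    · rw [Finset.card_sdiff_of_subset hSN]; omega
  · refine h.K A2 (insert b S) ?_ (by omega) ?_
    · intro p hp q hq
      rw [hA2, Finset.mem_filter] at hp
      have hpb : G.Adj p b := by
        have := hp.1
        rw [hA, Finset.mem_filter] at this
        exact this.2.symm
      rw [Finset.mem_insert] at hq
      rcases hq with rfl | hq
      · exact hpb
      · by_contra hn
        rcases hcase p hpb with hh | hh
        · exact hp.2 hh
        · exact hh q (hSN hq) hn hq
    · rw [Finset.card_insert_of_notMem hbS]; omega

set_option maxHeartbeats 4000000 in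
theorem Cls.exists_deg_le {V : Type*} [Fintype V] {d : ℕ} {G : SimpleGraph V} (hd : 1 ≤ d)
    (h : Cls d G) (v : V) : ∃ w, (Finset.univ.filter (G.Adj w)).card ≤ 2 * d := by
  by_contra! hdeg'
  have hdeg : ∀ v, 2 * d + 1 ≤ (Finset.univ.filter (G.Adj v)).card := fun v => hdeg' v
  clear hdeg'
  set N := Finset.univ.filter (G.Adj v) with hN
  have hNc : 2 * d + 1 ≤ N.card := hdeg v
  have memN : ∀ x, x ∈ N ↔ G.Adj v x := by intro x; simp [hN]
  clear_value N
  obtain ⟨T, hT⟩ : ∃ T : V → Finset V, T = fun a => N.filter (fun x => G.Adj a x) := ⟨_, rfl⟩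
  obtain ⟨C, hC⟩ : ∃ C : V → Finset V, C = fun a => N.filter (fun x => ¬ G.Adj a x) := ⟨_, rfl⟩
  have memT : ∀ a x, x ∈ T a ↔ x ∈ N ∧ G.Adj a x := by intro a x; simp [hT]
  have memC : ∀ a x, x ∈ C a ↔ x ∈ N ∧ ¬ G.Adj a x := by intro a x; simp [hC]
  have hTC : ∀ a, (T a).card + (C a).card = N.card := by
    intro a; rw [hT, hC]; exact Finset.card_filter_add_card_filter_not _
  clear hT hC
  have TsubN : ∀ a, T a ⊆ N := fun a x hx => ((memT a x).1 hx).1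
  have CsubN : ∀ a, C a ⊆ N := fun a x hx => ((memC a x).1 hx).1
  -- (S)
  have cross : ∀ a a' b x y z, b ∈ N → x ∈ N → y ∈ N → z ∈ N → G.Adj a b → G.Adj a' b →
      ¬ G.Adj a x → G.Adj a' x → G.Adj a y → ¬ G.Adj a' y → ¬ G.Adj a z → ¬ G.Adj a' z → False := by
    intro a a' b x y z hb hx hy hz h1 h2 h3 h4 h5 h6 h7 h8
    rw [memN] at hb hx hy hz
    exact h.stir v a a' b y x z hb hy hx hz h1 h5 h3 h7 h2 h6 h4 h8
  by_cases hI : ∃ a, d + 1 ≤ (T a).card ∧ d ≤ (C a).card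
  · obtain ⟨a0, hT0, hC0⟩ := hI
    have hb : ∃ b ∈ T a0, ∀ a, b ∈ T a → ¬ T a ⊂ T a0 := by
      by_contra! hcon
      obtain ⟨b0, hb0⟩ := Finset.card_pos.1 (by omega : 0 < (T a0).card)
      obtain ⟨a', ha', hs'⟩ := hcon b0 hb0
      obtain ⟨a1, ha1, hmax⟩ := Finset.exists_max_image
        (Finset.univ.filter (fun a => T a ⊂ T a0)) (fun a => (T a).card) ⟨a', by simp [hs']⟩
      simp only [Finset.mem_filter, Finset.mem_univ, true_and] at ha1 hmax
      obtain ⟨x2, hx2, hx2'⟩ := Finset.exists_of_ssubset ha1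
      obtain ⟨a2, ha2, hs2⟩ := hcon x2 hx2
      have : ∃ x1 ∈ T a1, x1 ∉ T a2 := by
        by_contra! hc
        have hss : T a1 ⊂ T a2 := ⟨hc, fun hh => hx2' (hh ha2)⟩
        have := Finset.card_lt_card hss
        have := hmax a2 hs2
        omega
      obtain ⟨x1, hx1, hx1'⟩ := this
      obtain ⟨z, hz⟩ := Finset.card_pos.1 (by omega : 0 < (C a0).card)
      have hz1 : z ∉ T a1 := fun hh => ((memC _ _).1 hz).2 ((memT _ _).1 (ha1.1 hh)).2
      have hz2 : z ∉ T a2 := fun hh => ((memC _ _).1 hz).2 ((memT _ _).1 (hs2.1 hh)).2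
      have hx10 := ha1.1 hx1
      simp only [memT, memC, memN] at *
      -- cycle x1, v, x2, a0 ; pendants a1, z, a2
      clear cross hcon hmax
      refine h.arm x1 x2 z v a0 a1 a2 ?_ ?_ ?_ ?_ ?_ ?_ ?_ ?_ ?_ ?_ ?_ ?_ <;>
        (rw [G.adj_comm]; tauto)
    obtain ⟨b, hb, hbm⟩ := hb
    have hbC : b ∉ C a0 := fun hh => ((memC _ _).1 hh).2 ((memT _ _).1 hb).2
    refine h.final_biclique hdeg N (C a0) b (TsubN _ hb) hbC (CsubN _) hC0
      (by have := hTC a0; omega) ?_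
    intro a hab
    by_contra! hcon
    obtain ⟨⟨x, hx, hxa, hx0⟩, ⟨z, hz, hza, hz0⟩⟩ := hcon
    refine hbm a ((memT _ _).2 ⟨TsubN _ hb, hab⟩) ⟨?_, ?_⟩
    · intro y hy
      by_contra hy0
      rw [memT] at hy hy0 hb
      rw [memC] at hx0 hz0
      refine cross a a0 b x y z (hb.1) hx hy.1 hz hab hb.2 hxa ?_ hy.2 ?_ hza hz0.2
      · by_contra hh; exact hx0 ⟨hx, hh⟩
      · intro hh; exact hy0 ⟨hy.1, hh⟩
    · intro hh
      have : x ∈ T a0 := by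
        rw [memT]; refine ⟨hx, ?_⟩
        by_contra hh'
        exact hx0 ((memC _ _).2 ⟨hx, hh'⟩)
      exact hxa ((memT _ _).1 (hh this)).2
  · have hII : ∀ a, (T a).card ≤ d ∨ (C a).card + 1 ≤ d := by
      intro a
      by_contra! hcon
      exact hI ⟨a, by omega, by omega⟩
    clear hI
    -- family
    obtain ⟨F, hF⟩ : ∃ F : Finset V → Prop, ∀ X, F X ↔ ((∃ a, X = T a ∧ (T a).card ≤ d) ∨
      (∃ a, X = C a ∧ (C a).card + 1 ≤ d) ∨ ∃ x ∈ N, X = {x}) := ⟨_, fun X => Iff.rfl⟩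
    have Fcard : ∀ X, F X → X.card ≤ d := by
      intro X hX
      rw [hF] at hX
      rcases hX with ⟨a, rfl, h⟩ | ⟨a, rfl, h⟩ | ⟨x, hx, rfl⟩
      · exact h
      · omega
      · simpa using hd
    have FsubN : ∀ X, F X → X ⊆ N := by
      intro X hX
      rw [hF] at hX
      rcases hX with ⟨a, rfl, h⟩ | ⟨a, rfl, h⟩ | ⟨x, hx, rfl⟩
      · exact TsubN a
      · exact CsubN a
      · simpa using hx
    have outside : ∀ X Y : Finset V, X.card ≤ d → Y.card ≤ d → ∃ z ∈ N, z ∉ X ∧ z ∉ Y := by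
      intro X Y hX hY
      have := Finset.card_union_le X Y
      obtain ⟨z, hz, hz'⟩ := Finset.exists_mem_notMem_of_card_lt_card (s := X ∪ Y) (t := N) (by omega)
      rw [Finset.mem_union, not_or] at hz'
      exact ⟨z, hz, hz'⟩
    have lam : ∀ X Y, F X → F Y → ∀ w, w ∈ X → w ∈ Y → X ⊆ Y ∨ Y ⊆ X := by
      intro X Y hX hY w hwX hwY
      by_contra! hcon
      obtain ⟨h1, h2⟩ := hcon
      rw [Finset.not_subset] at h1 h2
      obtain ⟨x, hxX, hxY⟩ := h1
      obtain ⟨y, hyY, hyX⟩ := h2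
      obtain ⟨z, hzN, hzX, hzY⟩ := outside X Y (Fcard _ hX) (Fcard _ hY)
      have hwN := FsubN _ hX hwX
      have hxN := FsubN _ hX hxX
      have hyN := FsubN _ hY hyY
      rw [hF] at hX hY
      rcases hX with ⟨a, rfl, h⟩ | ⟨a, rfl, h⟩ | ⟨x', hx', rfl⟩
      · rcases hY with ⟨a', rfl, h'⟩ | ⟨a', rfl, h'⟩ | ⟨x', hx', rfl⟩
        · simp only [memT, memC] at *
          exact cross a a' w y x z hwN hyN hxN hzN (by tauto) (by tauto) (by tauto) (by tauto)
            (by tauto) (by tauto) (by tauto) (by tauto)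
        · simp only [memT, memC] at *
          exact cross a a' x z w y hxN hzN hwN hyN (by tauto) (by tauto) (by tauto) (by tauto)
            (by tauto) (by tauto) (by tauto) (by tauto)
        · simp only [Finset.mem_singleton] at *
          subst hwY; subst hyY; exact hyX hwX
      · rcases hY with ⟨a', rfl, h'⟩ | ⟨a', rfl, h'⟩ | ⟨x', hx', rfl⟩
        · simp only [memT, memC] at *
          exact cross a a' y w z x hyN hwN hzN hxN (by tauto) (by tauto) (by tauto) (by tauto)
            (by tauto) (by tauto) (by tauto) (by tauto)
        · simp only [memT, memC] at *
          exact cross a a' z x y w hzN hxN hyN hwN (by tauto) (by tauto) (by tauto) (by tauto)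
            (by tauto) (by tauto) (by tauto) (by tauto)
        · simp only [Finset.mem_singleton] at *
          subst hwY; subst hyY; exact hyX hwX
      · simp only [Finset.mem_singleton] at *
        subst hwX; subst hxX; exact hxY hwY
    -- saturated sets
    obtain ⟨Sat, hSat⟩ : ∃ Sat : Finset V → Prop, ∀ S, Sat S ↔ ∀ X, F X → X ⊆ S ∨ Disjoint X S :=
      ⟨_, fun X => Iff.rfl⟩
    have SatE : Sat ∅ := by rw [hSat]; intro X hX; right; simp
    have block : ∀ x ∈ N, ∃ M, F M ∧ Sat M ∧ x ∈ M := by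
      intro x hx
      obtain ⟨M, hM, hmax⟩ := Finset.exists_max_image (N.powerset.filter (fun X => F X ∧ x ∈ X))
        Finset.card ⟨{x}, by simp only [Finset.mem_filter, Finset.mem_powerset]; exact ⟨by simpa using hx, (hF _).2 (Or.inr (Or.inr ⟨x, hx, rfl⟩)), by simp⟩⟩
      simp only [Finset.mem_filter, Finset.mem_powerset] at hM hmax
      refine ⟨M, hM.2.1, ?_, hM.2.2⟩
      rw [hSat]
      intro X hX
      by_cases hdis : Disjoint X M
      · exact Or.inr hdis
      left
      rw [Finset.not_disjoint_iff] at hdis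
      obtain ⟨y, hyX, hyM⟩ := hdis
      rcases lam X M hX hM.2.1 y hyX hyM with h1 | h1
      · exact h1
      · have := hmax X ⟨FsubN _ hX, hX, h1 hM.2.2⟩
        rw [Finset.eq_of_subset_of_card_le h1 this]
    have satdis : ∀ S, Sat S → ∀ M, F M → ∀ x ∈ M, x ∉ S → Disjoint M S := by
      intro S hS M hM x hx hxS
      rcases (hSat S).1 hS M hM with h1 | h1
      · exact absurd (h1 hx) hxS
      · exact h1
    -- the two blocks
    have hW : ∃ B1 B2, Sat B1 ∧ Sat B2 ∧ B1 ⊆ N ∧ B1.card ≤ d ∧ B2.card ≤ d ∧ Disjoint B1 B2 ∧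
        ∀ a x, (T a).card ≤ d → x ∈ T a → x ∈ B1 ∨ x ∈ B2 := by
      by_cases hW0 : ∃ a1 x1, (T a1).card ≤ d ∧ x1 ∈ T a1
      swap
      · push Not at hW0
        exact ⟨∅, ∅, SatE, SatE, by simp, by simp, by simp, by simp,
          fun a x h1 h2 => absurd h2 (hW0 a x h1)⟩
      obtain ⟨a1, x1, hs1, hx1⟩ := hW0
      obtain ⟨B1, hB1F, hB1S, hxB1⟩ := block x1 (TsubN _ hx1)
      by_cases hW1 : ∃ a2 x2, (T a2).card ≤ d ∧ x2 ∈ T a2 ∧ x2 ∉ B1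
      swap
      · push Not at hW1
        exact ⟨B1, ∅, hB1S, SatE, FsubN _ hB1F, Fcard _ hB1F, by simp, by simp,
          fun a x h1 h2 => Or.inl (hW1 a x h1 h2)⟩
      obtain ⟨a2, x2, hs2, hx2, hxB⟩ := hW1
      obtain ⟨B2, hB2F, hB2S, hxB2⟩ := block x2 (TsubN _ hx2)
      have hdis : Disjoint B2 B1 := satdis B1 hB1S B2 hB2F x2 hxB2 hxB
      refine ⟨B1, B2, hB1S, hB2S, FsubN _ hB1F, Fcard _ hB1F, Fcard _ hB2F, hdis.symm, ?_⟩
      intro a3 x3 hs3 hx3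
      by_contra! hcon
      obtain ⟨hn1, hn2⟩ := hcon
      have hTF : ∀ a, (T a).card ≤ d → F (T a) := fun a ha => (hF _).2 (Or.inl ⟨a, rfl, ha⟩)
      have d31 := satdis B1 hB1S _ (hTF a3 hs3) x3 hx3 hn1
      have d32 := satdis B2 hB2S _ (hTF a3 hs3) x3 hx3 hn2
      have d21 := satdis B1 hB1S _ (hTF a2 hs2) x2 hx2 hxB
      have d12 := satdis B2 hB2S _ (hTF a1 hs1) x1 hx1
        (fun hh => Finset.disjoint_left.1 hdis hh hxB1)
      rw [Finset.disjoint_left] at d31 d32 d21 d12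
      have q : ∀ a x, x ∈ N → x ∉ T a → ¬ G.Adj a x := by
        intro a x hx hxa hh; exact hxa ((memT _ _).2 ⟨hx, hh⟩)
      have i1 : x3 ∉ T a1 := by
        rcases (hSat B1).1 hB1S _ (hTF a1 hs1) with h1 | h1
        · exact fun hh => hn1 (h1 hh)
        · exact absurd hxB1 (Finset.disjoint_left.1 h1 hx1)
      have i2 : x3 ∉ T a2 := by
        rcases (hSat B2).1 hB2S _ (hTF a2 hs2) with h1 | h1
        · exact fun hh => hn2 (h1 hh)
        · exact absurd hxB2 (Finset.disjoint_left.1 h1 hx2)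
      refine h.tri v a1 a2 a3 x1 x2 x3 ((memN _).1 (TsubN _ hx1)) ((memN _).1 (TsubN _ hx2))
        ((memN _).1 (TsubN _ hx3)) ((memT _ _).1 hx1).2 (q _ _ (TsubN _ hx2) fun hh => d12 hh hxB2)
        (q _ _ (TsubN _ hx3) i1) (q _ _ (TsubN _ hx1) fun hh => d21 hh hxB1) ((memT _ _).1 hx2).2
        (q _ _ (TsubN _ hx3) i2) (q _ _ (TsubN _ hx1) fun hh => d31 hh hxB1)
        (q _ _ (TsubN _ hx2) fun hh => d32 hh hxB2) ((memT _ _).1 hx3).2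
    obtain ⟨B1, B2, hB1, hB2, hB1N, hB1c, hB2c, hB12, hWB⟩ := hW
    obtain ⟨S, hS, hSmax⟩ := Finset.exists_max_image
      (N.powerset.filter (fun X => Sat X ∧ B1 ⊆ X ∧ Disjoint X B2 ∧ X.card ≤ d))
      Finset.card ⟨B1, by simp only [Finset.mem_filter, Finset.mem_powerset]; exact ⟨hB1N, hB1, by simp, hB12, hB1c⟩⟩
    simp only [Finset.mem_filter, Finset.mem_powerset] at hS hSmax
    obtain ⟨hSN, hSsat, hB1S, hSB2, hSc⟩ := hS
    obtain ⟨x, hxN, hxS, hxB2⟩ := outside S B2 hSc hB2c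
    obtain ⟨M, hMF, hMsat, hxM⟩ := block x hxN
    have hMS := satdis S hSsat M hMF x hxM hxS
    have hMB2 := satdis B2 hB2 M hMF x hxM hxB2
    have hSM : d < S.card + M.card := by
      by_contra! hle
      have hcu : (S ∪ M).card = S.card + M.card := Finset.card_union_of_disjoint hMS.symm
      have := hSmax (S ∪ M) ⟨Finset.union_subset hSN (FsubN _ hMF), ?_,
        hB1S.trans Finset.subset_union_left, Finset.disjoint_union_left.2 ⟨hSB2, hMB2⟩, by omega⟩
      · have : 0 < M.card := Finset.card_pos.2 ⟨x, hxM⟩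
        omega
      · rw [hSat]
        intro X hX
        rcases (hSat _).1 hSsat X hX with h1 | h1
        · left; exact h1.trans Finset.subset_union_left
        · rcases (hSat _).1 hMsat X hX with h2 | h2
          · left; exact h2.trans Finset.subset_union_right
          · right; exact Finset.disjoint_union_right.2 ⟨h1, h2⟩
    have hMW : ∀ a y, y ∈ M → y ∈ T a → (C a).card + 1 ≤ d := by
      intro a y hyM hyT
      rcases hII a with h1 | h1
      · exfalso
        rcases hWB a y h1 hyT with h2 | h2
        · exact Finset.disjoint_left.1 hMS hyM (hB1S h2)
        · exact Finset.disjoint_left.1 hMB2 hyM h2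
      · exact h1
    obtain ⟨M', hM'M, hM'c, b, hbM, hbM', hbC⟩ := chain_pick M
      (M.powerset.filter (fun X => ∃ a, X = C a ∧ (C a).card + 1 ≤ d)) (d - S.card) (by omega)
      (by intro X hX; simp only [Finset.mem_filter, Finset.mem_powerset] at hX; exact hX.1)
      (by
        intro X hX Y hY
        simp only [Finset.mem_filter, Finset.mem_powerset] at hX hY
        obtain ⟨hXM, a1, rfl, ha1⟩ := hX
        obtain ⟨hYM, a2, rfl, ha2⟩ := hY
        by_contra! hcon
        obtain ⟨h1, h2⟩ := hcon
        rw [Finset.not_subset] at h1 h2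
        obtain ⟨x1, hx1, hx1'⟩ := h1
        obtain ⟨x2, hx2, hx2'⟩ := h2
        have hMF' := hMF
        rw [hF] at hMF'
        rcases hMF' with ⟨a, rfl, hh⟩ | ⟨a3, rfl, hh⟩ | ⟨y, hy, rfl⟩
        · have hc := hMW a x hxM hxM
          have := hTC a
          omega
        · obtain ⟨c, hcN, hc, -⟩ := outside (C a3) (C a3) (by omega) (by omega)
          have hc1 : c ∉ C a1 := fun hh => hc (hXM hh)
          have hc2 : c ∉ C a2 := fun hh => hc (hYM hh)
          have hx13 := hXM hx1
          have hx23 := hYM hx2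
          simp only [memC, memN] at hcN hc hc1 hc2 hx1 hx1' hx2 hx2' hx13 hx23
          clear cross lam
          refine h.stir c x2 x1 v a1 a2 a3 ?_ ?_ ?_ ?_ ?_ ?_ ?_ ?_ ?_ ?_ ?_ ?_ <;>
            (rw [G.adj_comm]; tauto)
        · have e1 := hXM hx1
          have e2 := hYM hx2
          rw [Finset.mem_singleton] at e1 e2
          subst e1; subst e2; exact hx1' hx2)
    have hM'S : Disjoint S M' := Finset.disjoint_of_subset_right hM'M hMS.symm
    have hcu : (S ∪ M').card = S.card + M'.card := Finset.card_union_of_disjoint hM'S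
    refine h.final_biclique hdeg N (S ∪ M') b (FsubN _ hMF hbM) ?_ ?_ (by omega) (by omega) ?_
    · rw [Finset.mem_union, not_or]
      exact ⟨Finset.disjoint_left.1 hMS hbM, hbM'⟩
    · exact Finset.union_subset hSN (hM'M.trans (FsubN _ hMF))
    · intro a hab
      have hac := hMW a b hbM ((memT _ _).2 ⟨FsubN _ hMF hbM, hab⟩)
      have hFa : F (C a) := (hF _).2 (Or.inr (Or.inl ⟨a, rfl, hac⟩))
      rcases (hSat _).1 hSsat _ hFa with h1 | h1
      · left; intro y hy hya
        exact Finset.mem_union_left _ (h1 ((memC _ _).2 ⟨hy, hya⟩))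
      · rcases (hSat _).1 hMsat _ hFa with h2 | h2
        · left; intro y hy hya
          refine Finset.mem_union_right _ (hbC (C a) ?_ ?_ ((memC _ _).2 ⟨hy, hya⟩))
          · simp only [Finset.mem_filter, Finset.mem_powerset]
            exact ⟨h2, a, rfl, hac⟩
          · intro hh; exact ((memC _ _).1 hh).2 hab
        · right; intro y hy hya hyS
          rw [Finset.mem_union] at hyS
          have hyC := (memC _ _).2 ⟨hy, hya⟩
          rcases hyS with h3 | h3
          · exact Finset.disjoint_left.1 h1 hyC h3
          · exact Finset.disjoint_left.1 h2 hyC (hM'M h3)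

/-- Local windows around the vertices of a hole. -/
theorem hole_windows {V : Type*} {G : SimpleGraph V} (p : V) (k : ℕ) (r : ℕ → V) (hk : 4 ≤ k)
    (h1 : ∀ i j, i ≤ k → j ≤ k → (G.Adj (r i) (r j) ↔ i + 1 = j ∨ j + 1 = i))
    (h2 : ∀ i, i ≤ k → (G.Adj p (r i) ↔ i = 0 ∨ i = k)) :
    ∃ H : Set V, p ∈ H ∧ (∀ x ∈ H, x = p ∨ ∃ i ≤ k, x = r i) ∧ ∀ t ∈ H, ∃ c : ℤ → V, c 0 = t ∧
      (∀ i, c i ∈ H) ∧ ∀ i j : ℤ, |i - j| ≤ 4 → (G.Adj (c i) (c j) ↔ |i - j| = 1) := by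
  obtain ⟨f, hf⟩ : ∃ f : ℤ → V, f = fun (m : ℤ) => if m = (k : ℤ) + 1 then p else r m.toNat := ⟨_, rfl⟩
  have hadj : ∀ m m' : ℤ, 0 ≤ m → m < k + 2 → 0 ≤ m' → m' < k + 2 →
      (G.Adj (f m) (f m') ↔ (m + 1 = m' ∨ m' + 1 = m ∨ (m = 0 ∧ m' = k + 1) ∨ (m' = 0 ∧ m = k + 1))) := by
    intro m m' a b a' b'
    have fp : ∀ m : ℤ, m = k + 1 → f m = p := by intro m hm; simp [hf, hm]
    have fr : ∀ m : ℤ, m ≠ k + 1 → f m = r m.toNat := by intro m hm; simp [hf, hm]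
    by_cases hm : m = k + 1
    · by_cases hm' : m' = k + 1
      · rw [fp m hm, fp m' hm']
        simp only [SimpleGraph.irrefl, false_iff]; omega
      · rw [fp m hm, fr m' hm', h2 _ (by omega)]; omega
    · by_cases hm' : m' = k + 1
      · rw [fr m hm, fp m' hm', G.adj_comm, h2 _ (by omega)]; omega
      · rw [fr m hm, fr m' hm', h1 _ _ (by omega) (by omega)]; omega
  refine ⟨{x | ∃ m : ℤ, 0 ≤ m ∧ m < k + 2 ∧ x = f m}, ⟨k + 1, by omega, by omega, by simp [hf]⟩, ?_, ?_⟩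
  · rintro x ⟨m, a, b, rfl⟩
    rw [hf]
    by_cases hm : m = k + 1
    · left; simp [hm]
    · right; exact ⟨m.toNat, by omega, by simp [hm]⟩
  · rintro t ⟨m0, a, b, rfl⟩
    refine ⟨fun i => f ((i + m0) % ((k : ℤ) + 2)), ?_, ?_, ?_⟩
    · simp only [zero_add]
      rw [Int.emod_eq_of_lt a b]
    · intro i
      exact ⟨_, Int.emod_nonneg _ (by omega), Int.emod_lt_of_pos _ (by omega), rfl⟩
    · intro i j hij
      have hn : (0 : ℤ) < k + 2 := by omega
      have e1 := Int.emod_nonneg (i + m0) (ne_of_gt hn)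
      have e2 := Int.emod_lt_of_pos (i + m0) hn
      have e3 := Int.emod_nonneg (j + m0) (ne_of_gt hn)
      have e4 := Int.emod_lt_of_pos (j + m0) hn
      rw [hadj _ _ e1 e2 e3 e4]
      have d1 := Int.emod_add_mul_ediv (i + m0) (k + 2)
      have d2 := Int.emod_add_mul_ediv (j + m0) (k + 2)
      generalize (i + m0) % ((k : ℤ) + 2) = x at *
      generalize (j + m0) % ((k : ℤ) + 2) = y at *
      generalize (i + m0) / ((k : ℤ) + 2) = q at *
      generalize (j + m0) / ((k : ℤ) + 2) = q' at *
      have d3 : i - j = (x - y) + ((k : ℤ) + 2) * (q - q') := by linarith [mul_sub ((k : ℤ) + 2) q q']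
      obtain ⟨e, he⟩ : ∃ e, e = q - q' := ⟨_, rfl⟩
      rw [← he] at d3
      rw [abs_le] at hij
      have u1 : e < 2 := by
        by_contra hh
        push Not at hh
        nlinarith
      have u2 : -2 < e := by
        by_contra hh
        push Not at hh
        nlinarith
      have : |i - j| = 1 ↔ i - j = 1 ∨ i - j = -1 := by
        rw [abs_eq (by norm_num)]
      rw [this]
      have he3 : e = -1 ∨ e = 0 ∨ e = 1 := by omega
      rcases he3 with rfl | rfl | rfl <;> omega

theorem HoleFr.of_delete {V : Type*} {d : ℕ} {G : SimpleGraph V} (h : Cls d G) (hc : G.Connected)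
    (v : V) : HoleFr (G.induce {x | G.Adj v x}ᶜ) := by
  intro p k r hk h1 h2
  obtain ⟨H, hpH, hH, hwin⟩ := hole_windows (G := G) p k (fun i => r i) hk
    (fun i j hi hj => by simpa using h1 i j hi hj) (fun i hi => by simpa using h2 i hi)
  have hvH : ∀ x ∈ H, ¬ G.Adj v x := by
    intro x hx
    rcases hH x hx with rfl | ⟨i, hi, rfl⟩
    · exact p.2
    · exact (r i).2
  have hdom : ∀ x ∈ H, ∃ y ∈ H, G.Adj x y := by
    intro x hx
    obtain ⟨c, rfl, hcH, hcc⟩ := hwin x hx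
    exact ⟨c 1, hcH 1, (hcc 0 1 (by norm_num)).2 (by norm_num)⟩
  -- walk
  have key : ∀ w, Relation.ReflTransGen G.Adj (p : V) w →
      (∃ z ∈ H, G.Adj w z) ∨ ∃ x y t, G.Adj x y ∧ t ∈ H ∧ G.Adj x t ∧ ∀ z ∈ H, ¬ G.Adj y z := by
    intro w hw
    induction hw with
    | refl => left; exact hdom _ hpH
    | tail hb hbc ih =>
      rename_i b c
      rcases ih with ⟨t, ht, hbt⟩ | ih
      · by_cases hcz : ∃ z ∈ H, G.Adj c z
        · exact Or.inl hcz
        · push Not at hcz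
          exact Or.inr ⟨b, c, t, hbc, ht, hbt, hcz⟩
      · exact Or.inr ih
  have hreach := hc.preconnected (p : V) v
  rw [SimpleGraph.reachable_iff_reflTransGen] at hreach
  rcases key v hreach with ⟨z, hz, hvz⟩ | ⟨x, y, t, hxy, ht, hxt, hy⟩
  · exact hvH z hz hvz
  obtain ⟨c, rfl, hcH, hcc⟩ := hwin t ht
  have hyc : ∀ i, ¬ G.Adj y (c i) := fun i => hy _ (hcH i)
  by_cases h2 : G.Adj x (c 2)
  · refine h.arm (c 0) (c 2) y x (c 1) (c (-1)) (c 3) hxt.symm ?_ ?_ ?_ h2.symm ?_ ?_ ?_ hxy.symm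
      (hyc _) (hyc _) (hyc _) <;> (rw [hcc] <;> norm_num [abs_of_nonneg])
  by_cases h3 : G.Adj x (c (-2))
  · refine h.arm (c 0) (c (-2)) y x (c (-1)) (c 1) (c (-3)) hxt.symm ?_ ?_ ?_ h3.symm ?_ ?_ ?_ hxy.symm
      (hyc _) (hyc _) (hyc _) <;> (rw [hcc] <;> norm_num [abs_of_nonneg])
  refine h.tri (c 0) (c 2) (c (-2)) y (c 1) (c (-1)) x ?_ ?_ hxt.symm ?_ ?_ (fun hh => h2 hh.symm) ?_ ?_
    (fun hh => h3 hh.symm) (hyc _) (hyc _) hxy.symm <;> (rw [hcc] <;> norm_num [abs_of_nonneg])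

/-- A walk `r 0, ..., r k` in `G - N[u]`. -/
structure Pth {V : Type*} (G : SimpleGraph V) (u : V) (k : ℕ) (r : ℕ → V) : Prop where
  step : ∀ i, i < k → G.Adj (r i) (r (i + 1))
  ne : ∀ i, i ≤ k → r i ≠ u
  na : ∀ i, i ≤ k → ¬ G.Adj u (r i)

theorem Pth.sub {V : Type*} {G : SimpleGraph V} {u : V} {k : ℕ} {r : ℕ → V} (h : Pth G u k r)
    (i j : ℕ) (hij : i ≤ j) (hj : j ≤ k) : Pth G u (j - i) (fun t => r (i + t)) :=
  ⟨fun t ht => h.step (i + t) (by omega), fun t ht => h.ne _ (by omega), fun t ht => h.na _ (by omega)⟩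

theorem Pth.shortcut {V : Type*} {G : SimpleGraph V} {u : V} {k : ℕ} {r : ℕ → V} (h : Pth G u k r)
    (i j : ℕ) (hij : i + 1 < j) (hj : j ≤ k) (ha : G.Adj (r i) (r j)) :
    ∃ k' r', k' < k ∧ Pth G u k' r' ∧ r' 0 = r 0 ∧ r' k' = r k := by
  refine ⟨k - (j - i - 1), fun t => if t ≤ i then r t else r (t + (j - i - 1)), by omega, ⟨?_, ?_, ?_⟩, ?_, ?_⟩
  · intro t ht
    by_cases h1 : t + 1 ≤ i
    · simp only [h1, if_true, (by omega : t ≤ i)]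
      exact h.step t (by omega)
    · by_cases h2 : t = i
      · subst h2
        simp only [le_refl, if_true, h1, if_false]
        rw [show t + 1 + (j - t - 1) = j by omega]
        exact ha
      · rw [if_neg h1, if_neg (by omega)]
        rw [show t + 1 + (j - i - 1) = t + (j - i - 1) + 1 by omega]
        exact h.step _ (by omega)
  · intro t ht
    split_ifs
    · exact h.ne _ (by omega)
    · exact h.ne _ (by omega)
  · intro t ht
    split_ifs
    · exact h.na _ (by omega)
    · exact h.na _ (by omega)
  · simp
  · dsimp only
    rw [if_neg (by omega)]
    congr 1; omega

theorem Pth.induced {V : Type*} {G : SimpleGraph V} {u : V} {k : ℕ} {r : ℕ → V} (h : Pth G u k r)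
    (hmin : ∀ k' r', k' < k → Pth G u k' r' → r' 0 = r 0 → r' k' = r k → False) :
    ∀ i j, i ≤ k → j ≤ k → (G.Adj (r i) (r j) ↔ i + 1 = j ∨ j + 1 = i) := by
  have key : ∀ i j, i < j → j ≤ k → (G.Adj (r i) (r j) ↔ i + 1 = j ∨ j + 1 = i) := by
    intro i j hij hj
    constructor
    · intro ha
      by_contra hcon
      obtain ⟨k', r', h1, h2, h3, h4⟩ := h.shortcut i j (by omega) hj ha
      exact hmin k' r' h1 h2 h3 h4
    · rintro (rfl | h')
      · exact h.step i (by omega)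
      · omega
  intro i j hi hj
  rcases lt_trichotomy i j with hlt | rfl | hlt
  · exact key i j hlt hj
  · simp
  · rw [G.adj_comm, key j i hlt hi, or_comm]

theorem Pth.parity {V : Type*} {G : SimpleGraph V} {u : V} {k : ℕ} {r : ℕ → V} (h : Pth G u k r)
    (χ : V → Bool) (hχ : ∀ u v, G.Adj u v → χ u ≠ χ v) :
    ∀ i, i ≤ k → (χ (r i) = χ (r 0) ↔ i % 2 = 0) := by
  intro i
  induction i with
  | zero => intro _; simp
  | succ i ih =>
    intro hi
    have h1 := ih (by omega)
    have h2 := hχ _ _ (h.step i (by omega))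
    have : (i + 1) % 2 = 0 ↔ ¬ i % 2 = 0 := by omega
    rw [this, ← h1]
    revert h2
    generalize χ (r i) = a
    generalize χ (r (i + 1)) = b
    generalize χ (r 0) = c
    revert a b c
    decide

theorem HoleFr.first {V : Type*} {G : SimpleGraph V} (hH : HoleFr G) {k : ℕ} {r : ℕ → V}
    (hind : ∀ i j, i ≤ k → j ≤ k → (G.Adj (r i) (r j) ↔ i + 1 = j ∨ j + 1 = i))
    (p : V) (b : ℕ) (h0 : G.Adj p (r b)) (h1 : ¬ G.Adj p (r (b + 1))) (h2 : ¬ G.Adj p (r (b + 2)))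
    (h3 : ¬ G.Adj p (r (b + 3))) (hb : b + 4 ≤ k) (hk : G.Adj p (r k)) : False := by
  have hex : ∃ j, G.Adj p (r (b + 4 + j)) := ⟨k - (b + 4), by rwa [Nat.add_sub_cancel' hb]⟩
  have hj := Nat.find_spec hex
  have hmin : ∀ m, m < Nat.find hex → ¬ G.Adj p (r (b + 4 + m)) := fun m hm => Nat.find_min hex hm
  have hle : Nat.find hex ≤ k - (b + 4) := Nat.find_min' hex (by rwa [Nat.add_sub_cancel' hb])
  generalize Nat.find hex = j at *
  refine hH p (4 + j) (fun t => r (b + t)) (by omega) ?_ ?_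
  · intro i i' hi hi'
    rw [hind _ _ (by omega) (by omega)]; omega
  · intro i hi
    constructor
    · intro ha
      by_contra hcon
      rcases (by omega : i = 1 ∨ i = 2 ∨ i = 3 ∨ 4 ≤ i) with rfl | rfl | rfl | h4
      · exact h1 ha
      · exact h2 ha
      · exact h3 ha
      · refine hmin (i - 4) (by omega) ?_
        rwa [show b + 4 + (i - 4) = b + i by omega]
    · rintro (rfl | rfl)
      · exact h0
      · rwa [← add_assoc]

theorem lemA {V : Type*} {d : ℕ} {G : SimpleGraph V} (h : Cls d G) (hH : HoleFr G) (u x y : V)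
    (hx : G.Adj u x) (hy : G.Adj u y) (k : ℕ) (r : ℕ → V) (hr : Pth G u k r)
    (h1 : G.Adj x (r 0)) (h2 : ¬ G.Adj y (r 0)) (h3 : G.Adj y (r k)) (h4 : ¬ G.Adj x (r k)) : False := by
  obtain ⟨χ, hχ⟩ := h.bip
  induction k using Nat.strong_induction_on generalizing r with
  | _ k ih =>
  have hind := hr.induced (fun k' r' hlt hr' e0 ek => ih k' hlt r' hr' (by rwa [e0]) (by rwa [e0])
    (by rwa [ek]) (by rwa [ek]))
  have hpar := hr.parity χ hχ
  have oddx : ∀ i, i ≤ k → G.Adj x (r i) → i % 2 = 0 := by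
    intro i hi ha
    rw [← hpar i hi]
    have a1 := hχ _ _ ha
    have a2 := hχ _ _ h1
    revert a1 a2
    generalize χ (r i) = a; generalize χ (r 0) = b; generalize χ x = c
    revert a b c; decide
  have hkev : k % 2 = 0 := by
    rw [← hpar k le_rfl]
    have a1 := hχ _ _ h3
    have a2 := hχ _ _ h1
    have a3 := hχ _ _ hx
    have a4 := hχ _ _ hy
    revert a1 a2 a3 a4
    generalize χ (r k) = a; generalize χ (r 0) = b; generalize χ x = c; generalize χ y = e
    generalize χ u = f
    revert a b c e f; decide
  have hxy : ¬ G.Adj x y := by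
    intro ha
    have a1 := hχ _ _ ha
    have a3 := hχ _ _ hx
    have a4 := hχ _ _ hy
    revert a1 a3 a4
    generalize χ x = c; generalize χ y = e
    generalize χ u = f
    revert c e f; decide
  have hk0 : k ≠ 0 := by rintro rfl; exact h4 h1
  have both : ∀ j, 0 < j → j < k → (G.Adj x (r j) ↔ G.Adj y (r j)) := by
    intro j hj hjk
    constructor
    · intro ha
      by_contra hb
      refine ih (k - j) (by omega) (fun t => r (j + t)) (hr.sub j k (by omega) le_rfl) ha hb ?_ ?_
      · rwa [Nat.add_sub_cancel' (by omega)]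
      · rwa [Nat.add_sub_cancel' (by omega)]
    · intro ha
      by_contra hb
      refine ih j (by omega) r ?_ h1 h2 ha hb
      simpa using hr.sub 0 j (by omega) (by omega)
  by_cases hex : ∃ j, 0 < j ∧ j < k ∧ G.Adj x (r j)
  · have hj := Nat.find_spec hex
    have hmin : ∀ m, m < Nat.find hex → ¬ (0 < m ∧ m < k ∧ G.Adj x (r m)) :=
      fun m hm => Nat.find_min hex hm
    generalize Nat.find hex = j at *
    obtain ⟨j0, jk, hja⟩ := hj
    have hjev := oddx j (by omega) hja
    rcases (by omega : j = 2 ∨ 4 ≤ j) with rfl | hj4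
    · have hy2 := (both 2 (by omega) jk).1 hja
      refine h.stir (r 2) u (r 0) x y (r 1) (r 3) hja.symm hy2.symm ?_ ?_ hx hy
        (hr.na _ (by omega)) (hr.na _ (by omega)) h1.symm (fun hh => h2 hh.symm) ?_ ?_ <;>
      · rw [hind _ _ (by omega) (by omega)]; omega
    · refine hH x j r hj4 (fun i i' hi hi' => hind i i' (by omega) (by omega)) ?_
      intro i hi
      constructor
      · intro ha
        by_contra hcon
        exact hmin i (by omega) ⟨by omega, by omega, ha⟩
      · rintro (rfl | rfl)
        · exact h1
        · exact hja
  · push Not at hex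
    have hxn : ∀ j, 0 < j → j ≤ k → ¬ G.Adj x (r j) := by
      intro j hj hjk
      rcases Nat.lt_or_ge j k with hlt | hge
      · exact hex j hj hlt
      · rwa [(by omega : j = k)]
    have hyn : ∀ j, j < k → ¬ G.Adj y (r j) := by
      intro j hjk
      rcases Nat.eq_zero_or_pos j with rfl | hj
      · exact h2
      · rw [← both j hj hjk]; exact hex j hj hjk
    obtain ⟨s, hs⟩ : ∃ s : ℕ → V, s = fun t => if t ≤ k then r t else if t = k + 1 then y else u := ⟨_, rfl⟩
    have s1 : ∀ t, t ≤ k → s t = r t := by intro t ht; simp [hs, ht]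
    have s2 : s (k + 1) = y := by simp [hs]
    have s3 : s (k + 2) = u := by simp [hs]
    have key : ∀ i j, i ≤ j → j ≤ k + 2 → (G.Adj (s i) (s j) ↔ i + 1 = j) := by
      intro i j hij hj
      rcases (by omega : j ≤ k ∨ j = k + 1 ∨ j = k + 2) with hjk | rfl | rfl
      · rw [s1 i (by omega), s1 j hjk, hind _ _ (by omega) hjk]; omega
      · rcases (by omega : i < k ∨ i = k ∨ i = k + 1) with hi | rfl | rfl
        · rw [s1 i (by omega), s2, G.adj_comm]
          simp only [hyn i hi, false_iff]; omega
        · rw [s1 _ le_rfl, s2, G.adj_comm]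
          simp [h3]
        · simp
      · rcases (by omega : i ≤ k ∨ i = k + 1 ∨ i = k + 2) with hi | rfl | rfl
        · rw [s1 i (by omega), s3, G.adj_comm]
          simp only [hr.na i hi, false_iff]; omega
        · rw [s2, s3, G.adj_comm]
          simp [hy]
        · simp
    refine hH x (k + 2) s (by omega) ?_ ?_
    · intro i j hi hj
      rcases le_total i j with hij | hij
      · rw [key i j hij hj]; omega
      · rw [G.adj_comm, key j i hij hi]; omega
    · intro i hi
      rcases (by omega : i = 0 ∨ (0 < i ∧ i ≤ k) ∨ i = k + 1 ∨ i = k + 2) with rfl | ⟨h5, h6⟩ | rfl | rfl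
      · simp [s1, h1]
      · rw [s1 i h6]
        simp only [hxn i h5 h6, false_iff]; omega
      · rw [s2]; simp [hxy]
      · rw [s3]; simp [hx.symm]

theorem lemB {V : Type*} {d : ℕ} {G : SimpleGraph V} (h : Cls d G) (hH : HoleFr G) (u p x' y' : V)
    (hp : G.Adj u p) (hx' : ¬ G.Adj u x') (hy' : ¬ G.Adj u y') (k : ℕ) (r : ℕ → V) (hr : Pth G u k r)
    (h1 : G.Adj p (r 0)) (h2 : G.Adj p (r k)) (h3 : G.Adj x' (r 0)) (h4 : ¬ G.Adj x' (r k))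
    (h5 : G.Adj y' (r k)) (h6 : ¬ G.Adj y' (r 0)) : False := by
  obtain ⟨χ, hχ⟩ := h.bip
  induction k using Nat.strong_induction_on generalizing r with
  | _ k ih =>
  have hind := hr.induced (fun k' r' hlt hr' e0 ek => ih k' hlt r' hr' (by rwa [e0]) (by rwa [ek])
    (by rwa [e0]) (by rwa [ek]) (by rwa [ek]) (by rwa [e0]))
  have hpar := hr.parity χ hχ
  have oddp : ∀ i, i ≤ k → G.Adj p (r i) → i % 2 = 0 := by
    intro i hi ha
    rw [← hpar i hi]
    have a1 := hχ _ _ ha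
    have a2 := hχ _ _ h1
    revert a1 a2
    generalize χ (r i) = a; generalize χ (r 0) = b; generalize χ p = c
    revert a b c; decide
  have hkev := oddp k le_rfl h2
  have hk0 : k ≠ 0 := by rintro rfl; exact h4 h3
  rcases (by omega : k = 2 ∨ 4 ≤ k) with rfl | hk
  · refine h.arm (r 0) (r 2) u p (r 1) x' y' h1.symm ?_ h3.symm (fun hh => h6 hh.symm) h2.symm ?_
      (fun hh => h4 hh.symm) h5.symm hp (hr.na _ (by omega)) hx' hy' <;>
    · rw [hind _ _ (by omega) (by omega)]; omega
  have n1 : ¬ G.Adj p (r 1) := fun hh => by have := oddp 1 (by omega) hh; omega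
  have n3 : ¬ G.Adj p (r 3) := fun hh => by have := oddp 3 (by omega) hh; omega
  by_cases a2 : G.Adj p (r 2)
  · by_cases a4 : G.Adj p (r 4)
    · refine h.stir p (r 1) (r 3) (r 2) (r 0) (r 4) u a2 h1 a4 hp.symm ?_ ?_ ?_
        (fun hh => hr.na 1 (by omega) hh.symm) ?_ ?_ ?_ (fun hh => hr.na 3 (by omega) hh.symm) <;>
      · rw [hind _ _ (by omega) (by omega)]; omega
    · have hk4 : k ≠ 4 := by rintro rfl; exact a4 h2
      have n5 : ¬ G.Adj p (r 5) := fun hh => by have := oddp 5 (by omega) hh; omega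
      exact hH.first hind p 2 a2 n3 a4 n5 (by omega) h2
  · exact hH.first hind p 0 h1 n1 a2 n3 (by omega) h2

/-- Connectivity in `G - N[u]`. -/
def RN {V : Type*} (G : SimpleGraph V) (u : V) (x y : V) : Prop :=
  G.Adj x y ∧ (x ≠ u ∧ ¬ G.Adj u x) ∧ (y ≠ u ∧ ¬ G.Adj u y)

theorem RN.pth {V : Type*} {G : SimpleGraph V} {u x y : V} (hx : x ≠ u ∧ ¬ G.Adj u x)
    (h : Relation.ReflTransGen (RN G u) x y) : ∃ k r, Pth G u k r ∧ r 0 = x ∧ r k = y := by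
  induction h with
  | refl =>
    exact ⟨0, fun _ => x, ⟨fun i hi => by omega, fun _ _ => hx.1, fun _ _ => hx.2⟩, rfl, rfl⟩
  | tail hxb hbc ih =>
    rename_i b c
    obtain ⟨k, r, hr, h0, hk⟩ := ih
    obtain ⟨s, hs⟩ : ∃ s : ℕ → V, s = fun t => if t ≤ k then r t else c := ⟨_, rfl⟩
    have s1 : ∀ t, t ≤ k → s t = r t := by intro t ht; simp [hs, ht]
    have s2 : s (k + 1) = c := by simp [hs]
    refine ⟨k + 1, s, ⟨?_, ?_, ?_⟩, by rw [s1 0 (by omega), h0], s2⟩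
    · intro i hi
      rcases (by omega : i < k ∨ i = k) with hi | rfl
      · rw [s1 i (by omega), s1 (i + 1) (by omega)]; exact hr.step i hi
      · rw [s1 i le_rfl, s2, hk]; exact hbc.1
    · intro i hi
      rcases (by omega : i ≤ k ∨ i = k + 1) with hi | rfl
      · rw [s1 i hi]; exact hr.ne i hi
      · rw [s2]; exact hbc.2.2.1
    · intro i hi
      rcases (by omega : i ≤ k ∨ i = k + 1) with hi | rfl
      · rw [s1 i hi]; exact hr.na i hi
      · rw [s2]; exact hbc.2.2.2

theorem exists_good_choice {V : Type*} [Fintype V] {G : SimpleGraph V} (hc : G.Connected) :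
    ∃ (u : V) (C : Set V), (∀ x ∈ C, x ≠ u ∧ ¬ G.Adj u x) ∧
      (∀ x ∈ C, ∀ y ∈ C, Relation.ReflTransGen (RN G u) x y) ∧
      (∀ x ∈ C, ∀ y, RN G u x y → y ∈ C) ∧
      (∀ x, x ≠ u → ¬ G.Adj u x → ∃ z c, c ∈ C ∧ G.Adj u z ∧ G.Adj z c) ∧
      (∀ x z c, x ≠ u → ¬ G.Adj u x → x ∉ C → G.Adj u z → c ∈ C → G.Adj z c → G.Adj z x) := by
  by_cases hex : ∃ q : V × V, q.2 ≠ q.1 ∧ ¬ G.Adj q.1 q.2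
  swap
  · push Not at hex
    obtain ⟨u⟩ := hc.nonempty
    refine ⟨u, ∅, by simp, by simp, by simp, ?_, by simp⟩
    intro x hx hux
    exact absurd (hex (u, x) hx) hux
  obtain ⟨q0, hq0⟩ := hex
  obtain ⟨⟨u, w⟩, hq, hmax⟩ := Finset.exists_max_image
    (Finset.univ.filter (fun q : V × V => q.2 ≠ q.1 ∧ ¬ G.Adj q.1 q.2))
    (fun q => (Finset.univ.filter (fun x => Relation.ReflTransGen (RN G q.1) q.2 x)).card)
    ⟨q0, by simpa using hq0⟩
  simp only [Finset.mem_filter, Finset.mem_univ, true_and] at hq hmax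
  have symmR : ∀ x y, RN G u x y → RN G u y x := fun x y h => ⟨h.1.symm, h.2.2, h.2.1⟩
  have hC0 : ∀ x, Relation.ReflTransGen (RN G u) w x → x ≠ u ∧ ¬ G.Adj u x := by
    intro x hx
    rcases hx.cases_tail with rfl | ⟨y, _, hy⟩
    · exact hq
    · exact hy.2.2
  refine ⟨u, {x | Relation.ReflTransGen (RN G u) w x}, hC0, ?_, ?_, ?_, ?_⟩
  · intro x hx y hy
    have hx' : Relation.ReflTransGen (RN G u) x w := by
      have : Std.Symm (RN G u) := ⟨symmR⟩
      exact Relation.ReflTransGen.stdSymm.symm _ _ hx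
    exact hx'.trans hy
  · intro x hx y hxy
    exact Relation.ReflTransGen.tail hx hxy
  · intro _ _ _
    have hreach := hc.preconnected w u
    rw [SimpleGraph.reachable_iff_reflTransGen] at hreach
    have key : ∀ y, Relation.ReflTransGen G.Adj w y → Relation.ReflTransGen (RN G u) w y ∨
        ∃ z c, Relation.ReflTransGen (RN G u) w c ∧ G.Adj u z ∧ G.Adj z c := by
      intro y hy
      induction hy with
      | refl => left; exact Relation.ReflTransGen.refl
      | tail hb hbc ih =>
        rename_i b c
        rcases ih with ih | ih
        · have hb := hC0 _ ih
          by_cases hcu : c = u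
          · subst hcu; exact absurd hbc.symm hb.2
          by_cases hac : G.Adj u c
          · right; exact ⟨c, b, ih, hac, hbc.symm⟩
          · left; exact ih.tail ⟨hbc, hb, hcu, hac⟩
        · exact Or.inr ih
    rcases key u hreach with h | h
    · exact absurd rfl (hC0 _ h).1
    · exact h
  · intro x z c hxu hux hxC huz hcC hzc
    by_contra hzx
    have hCx : ∀ y, Relation.ReflTransGen (RN G u) w y → y ≠ x ∧ ¬ G.Adj x y := by
      intro y hy
      refine ⟨fun h => hxC (h ▸ hy), fun h => hxC ?_⟩
      exact hy.tail ⟨h.symm, hC0 _ hy, hxu, hux⟩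
    have hsub : ∀ y, Relation.ReflTransGen (RN G u) w y → Relation.ReflTransGen (RN G x) w y := by
      intro y hy
      induction hy with
      | refl => exact Relation.ReflTransGen.refl
      | tail hb hbc ih =>
        exact ih.tail ⟨hbc.1, hCx _ hb, hCx _ (hb.tail hbc)⟩
    have hw := hCx w Relation.ReflTransGen.refl
    have hlt := hmax (x, w) hw
    have hzx' : z ≠ x := by rintro rfl; exact hux huz
    refine absurd hlt (not_le_of_gt (Finset.card_lt_card ⟨?_, ?_⟩))
    · intro y hy
      simp only [Finset.mem_filter, Finset.mem_univ, true_and] at hy ⊢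
      exact hsub y hy
    · intro hh
      have hz : z ∈ Finset.univ.filter (fun y => Relation.ReflTransGen (RN G x) w y) := by
        simp only [Finset.mem_filter, Finset.mem_univ, true_and]
        exact (hsub c hcC).tail ⟨hzc.symm, hCx c hcC, hzx', fun h => hzx h.symm⟩
      have := hh hz
      simp only [Finset.mem_filter, Finset.mem_univ, true_and] at this
      exact (hC0 _ this).2 huz

theorem exists_layers {V : Type*} {d : ℕ} {G : SimpleGraph V} (h : Cls d G) (hc : G.Connected) (u : V) :
    ∃ D : V → ℕ, (∀ x, D x = 0 ↔ x = u) ∧ (∀ x, D x = 1 ↔ G.Adj u x) ∧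
      (∀ x y, G.Adj x y → D y = D x + 1 ∨ D x = D y + 1) ∧
      (∀ x i, D x = i + 1 → ∃ y, G.Adj y x ∧ D y = i) := by
  obtain ⟨χ, hχ⟩ := h.bip
  have h0 : ∀ x, G.dist u x = 0 ↔ x = u := by
    intro x
    rw [hc.dist_eq_zero_iff]; exact eq_comm
  have hadj : ∀ x y, G.Adj x y → G.dist u y ≤ G.dist u x + 1 := by
    intro x y hxy
    have := hc.dist_triangle (u := u) (v := x) (w := y)
    rw [SimpleGraph.dist_eq_one_iff_adj.2 hxy] at this
    exact this
  have hpar' : ∀ x, ∀ i, G.dist u x = i + 1 → ∃ y, G.Adj y x ∧ G.dist u y = i := by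
    intro x i hi
    obtain ⟨p, hp⟩ := hc.exists_walk_length_eq_dist x u
    rw [G.dist_comm, hi] at hp
    cases p with
    | nil => simp at hp
    | cons hxy q =>
      rename_i y
      simp only [SimpleGraph.Walk.length_cons] at hp
      refine ⟨y, hxy.symm, ?_⟩
      have h1 := SimpleGraph.dist_le q
      rw [G.dist_comm] at h1
      have := hadj y x hxy.symm
      omega
  have hcol : ∀ i x, G.dist u x = i → (χ x = χ u ↔ i % 2 = 0) := by
    intro i
    induction i with
    | zero => intro x hx; rw [h0] at hx; simp [hx]
    | succ i ih =>
      intro x hx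
      obtain ⟨y, hyx, hy⟩ := hpar' x i hx
      have h1 := ih y hy
      have h2 := hχ _ _ hyx
      have : (i + 1) % 2 = 0 ↔ ¬ i % 2 = 0 := by omega
      rw [this, ← h1]
      revert h2
      generalize χ x = a
      generalize χ y = b
      generalize χ u = c
      revert a b c
      decide
  refine ⟨fun x => G.dist u x, h0, fun x => SimpleGraph.dist_eq_one_iff_adj, ?_, hpar'⟩
  intro x y hxy
  have h1 := hadj x y hxy
  have h2 := hadj y x hxy.symm
  have h3 := hcol _ x rfl
  have h4 := hcol _ y rfl
  have h5 := hχ _ _ hxy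
  have h6 : (χ x = χ u ↔ ¬ χ y = χ u) := by
    revert h5
    generalize χ x = a
    generalize χ y = b
    generalize χ u = c
    revert a b c
    decide
  rw [h3, h4] at h6
  dsimp only
  omega

theorem lex_le {n m D D' p p' e e' : ℕ} (he' : e' < n) (hp' : p' < m)
    (h : (D * m + p) * n + e ≤ (D' * m + p') * n + e') : D < D' ∨ (D = D' ∧ p ≤ p') := by
  have h1 : D * m + p ≤ D' * m + p' := by
    by_contra hh
    push Not at hh
    have := Nat.mul_le_mul_right n (Nat.succ_le_of_lt hh)
    rw [Nat.succ_mul] at this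
    omega
  rcases lt_trichotomy D D' with hlt | rfl | hgt
  · exact Or.inl hlt
  · right; exact ⟨rfl, by omega⟩
  · exfalso
    have := Nat.mul_le_mul_right m (Nat.succ_le_of_lt hgt)
    rw [Nat.succ_mul] at this
    omega

theorem Cls.lay_of_connected {V : Type*} [Fintype V] {d : ℕ} {G : SimpleGraph V} (hd : 1 ≤ d)
    (h : Cls d G) (hH : HoleFr G) (hc : G.Connected) : Lay G (2 * d) := by
  by_cases hsub : Subsingleton V
  · refine ⟨fun _ => 0, fun x y _ => Subsingleton.elim x y, fun v => ?_⟩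
    have : (bagS G (fun _ => 0) v).ncard ≤ 1 :=
      (Set.ncard_le_one_iff).2 (fun {a b} _ _ => Subsingleton.elim a b)
    omega
  have hiso : ∀ x, ∃ y, G.Adj x y := by
    intro x
    rw [not_subsingleton_iff_nontrivial] at hsub
    obtain ⟨y, hy⟩ := exists_ne x
    have hr := hc.preconnected x y
    rw [SimpleGraph.reachable_iff_reflTransGen] at hr
    rcases hr.cases_head with h1 | ⟨z, hz, _⟩
    · exact absurd h1.symm hy
    · exact ⟨z, hz⟩
  clear hsub
  obtain ⟨u, C, hC0, hCc, hCl, hA, hT⟩ := exists_good_choice hc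
  obtain ⟨D, hD0, hD1, hDa, hDp⟩ := exists_layers h hc u
  have hfar : ∀ x, 2 ≤ D x → x ≠ u ∧ ¬ G.Adj u x := by
    intro x hx
    rw [Ne, ← hD0, ← hD1]; omega
  have hna : ∀ x y, D y ≠ D x + 1 → D x ≠ D y + 1 → ¬ G.Adj x y := by
    intro x y h1 h2 ha
    rcases hDa x y ha with h3 | h3
    · exact h1 h3
    · exact h2 h3
  have h3C : ∀ x, 3 ≤ D x → x ∈ C := by
    intro x hx
    by_contra hxC
    obtain ⟨hxu, hux⟩ := hfar x (by omega)
    obtain ⟨z, c, hcC, huz, hzc⟩ := hA x hxu hux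
    have hzx := hT x z c hxu hux hxC huz hcC hzc
    have hz1 := (hD1 z).2 huz
    rcases hDa z x hzx with h1 | h1 <;> omega
  have h2C : ∀ x x', D x = 2 → D x' = 3 → G.Adj x x' → x ∈ C := by
    intro x x' hx hx' ha
    exact hCl x' (h3C x' (by omega)) x ⟨ha.symm, hfar _ (by omega), hfar _ (by omega)⟩
  -- common parents
  have CPgen : ∀ i, 1 ≤ i → (∀ x y x' y', D x = i → D y = i → G.Adj x x' → G.Adj y y' → ¬ G.Adj y x' →
      ¬ G.Adj x y' → D x' = i + 1 → D y' = i + 1 → False) →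
      ∀ x y, D x = i + 1 → D y = i + 1 → ∃ p, D p = i ∧ G.Adj p x ∧ G.Adj p y := by
    intro i _ hC1 x y hx hy
    obtain ⟨p, hp, hpi⟩ := hDp x i hx
    obtain ⟨q, hq, hqi⟩ := hDp y i hy
    by_cases h1 : G.Adj p y
    · exact ⟨p, hpi, hp, h1⟩
    by_cases h2 : G.Adj q x
    · exact ⟨q, hqi, h2, hq⟩
    exact (hC1 p q x y hpi hqi hp hq h2 h1 hx hy).elim
  have C1 : ∀ i, 1 ≤ i → ∀ x y x' y', D x = i → D y = i → G.Adj x x' → G.Adj y y' → ¬ G.Adj y x' →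
      ¬ G.Adj x y' → D x' = i + 1 → D y' = i + 1 → False := by
    intro i
    induction i with
    | zero => intro h0; omega
    | succ i ih =>
      intro _ x y x' y' hx hy hxx hyy hyx hxy hx' hy'
      rcases (by omega : i = 0 ∨ i = 1 ∨ 2 ≤ i) with rfl | rfl | hi2
      · have hux := (hD1 x).1 hx
        have huy := (hD1 y).1 hy
        have fx := hfar x' (by omega)
        have fy := hfar y' (by omega)
        by_cases cx : x' ∈ C
        · by_cases cy : y' ∈ C
          · obtain ⟨k, r, hr, r0, rk⟩ := RN.pth fx (hCc x' cx y' cy)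
            subst r0; subst rk
            exact lemA h hH u x y hux huy k r hr hxx hyx hyy hxy
          · exact hxy (hT y' x x' fy.1 fy.2 cy hux cx hxx)
        · by_cases cy : y' ∈ C
          · exact hyx (hT x' y y' fx.1 fx.2 cx huy cy hyy)
          · obtain ⟨z, c, hcC, huz, hzc⟩ := hA x' fx.1 fx.2
            have z1 := hT x' z c fx.1 fx.2 cx huz hcC hzc
            have z2 := hT y' z c fy.1 fy.2 cy huz hcC hzc
            have n1 : ¬ G.Adj x c := fun hh => hxy (hT y' x c fy.1 fy.2 cy hux hcC hh)
            have n2 : ¬ G.Adj y c := fun hh => hyx (hT x' y c fx.1 fx.2 cx huy hcC hh)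
            exact h.stir z x y u x' y' c huz.symm z1 z2 hzc hux.symm hxx hxy n1 huy.symm hyx hyy n2
      · obtain ⟨p, hp, hpx, hpy⟩ := CPgen 1 le_rfl (ih le_rfl) x y hx hy
        have xC := h2C x x' hx hx' hxx
        have yC := h2C y y' hy hy' hyy
        obtain ⟨k, r, hr, r0, rk⟩ := RN.pth (hC0 x xC) (hCc x xC y yC)
        subst r0; subst rk
        exact lemB h hH u p x' y' ((hD1 p).1 hp) (hfar x' (by omega)).2 (hfar y' (by omega)).2
          k r hr hpx hpy hxx.symm (fun hh => hyx hh.symm) hyy.symm (fun hh => hxy hh.symm)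
      · obtain ⟨p, hp, hpx, hpy⟩ := CPgen i (by omega) (ih (by omega)) x y hx hy
        obtain ⟨q, hq, hqi⟩ := hDp p (i - 1) (by omega)
        obtain ⟨s, hs, hsi⟩ := hDp q (i - 2) (by omega)
        refine h.tri p x' y' s x y q hpx hpy hq.symm hxx.symm (fun hh => hyx hh.symm) ?_
          (fun hh => hxy hh.symm) hyy.symm ?_ ?_ ?_ hs
        all_goals exact hna _ _ (by omega) (by omega)
  have CP : ∀ i, 1 ≤ i → ∀ x y, D x = i + 1 → D y = i + 1 → ∃ p, D p = i ∧ G.Adj p x ∧ G.Adj p y :=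
    fun i hi => CPgen i hi (C1 i hi)
  have C1m : ∀ i x y p q, D x = i → D y = i → G.Adj p x → ¬ G.Adj p y → G.Adj q y → ¬ G.Adj q x →
      D p + 1 = i → D q + 1 = i → False := by
    intro i x y p q hx hy hpx hpy hqy hqx hp hq
    by_cases hi : i = 1
    · have e1 := (hD0 p).1 (by omega)
      have e2 := (hD0 q).1 (by omega)
      subst e1; subst e2; exact hpy hqy
    · exact C1 (D p) (by omega) p q x y rfl (by omega) hpx hqy hqx hpy (by omega) (by omega)
  have C3 : ∀ i x y p x', D x = i → D y = i → D p + 1 = i → G.Adj p x → ¬ G.Adj p y → D x' = i + 1 →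
      G.Adj x x' → ¬ G.Adj y x' → False := by
    intro i x y p x' hx hy hp hpx hpy hx' hxx hyx
    obtain ⟨q, hq, hqi⟩ := hDp y (i - 1) (by omega)
    have hqx : G.Adj q x := by
      by_contra hqx
      exact C1m i x y p q hx hy hpx hpy hq hqx hp (by omega)
    rcases (by omega : i = 1 ∨ i = 2 ∨ 3 ≤ i) with rfl | rfl | hi
    · have e1 := (hD0 p).1 (by omega)
      subst e1
      exact hpy ((hD1 y).1 hy)
    · have hup := (hD1 p).1 (by omega)
      have huq := (hD1 q).1 (by omega)
      have xC := h2C x x' hx hx' hxx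
      have fy := hfar y (by omega)
      have yC : y ∈ C := by
        by_contra hyC
        exact hpy (hT y p x fy.1 fy.2 hyC hup xC hpx)
      have hy' : ∃ y', G.Adj y y' ∧ D y' = 3 := by
        rcases (hCc y yC x xC).cases_head with e | ⟨y', hyy, _⟩
        · subst e; exact absurd hpx hpy
        · refine ⟨y', hyy.1, ?_⟩
          have h1 := hyy.2.2
          rw [← hD1] at h1
          rcases hDa y y' hyy.1 with h2 | h2 <;> omega
      obtain ⟨y', hyy, hy'⟩ := hy'
      have hxy : G.Adj x y' := by
        by_contra hxy
        exact C1 2 (by omega) x y x' y' hx hy hxx hyy hyx hxy hx' hy'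
      refine h.stir x u y q p y' x' hqx.symm hpx.symm hxy hxx huq hup ?_ ?_ hq.symm
        (fun hh => hpy hh.symm) hyy hyx
      · exact (hfar y' (by omega)).2
      · exact (hfar x' (by omega)).2
    · obtain ⟨r, hr, hrp, hrq⟩ := CP (i - 2) (by omega) p q (by omega) (by omega)
      obtain ⟨s, hs, hsi⟩ := hDp r (i - 3) (by omega)
      refine h.arm x r y q p x' s hqx.symm hpx.symm hxx ?_ hrq hrp ?_ hs.symm hq.symm
        (fun hh => hpy hh.symm) hyx ?_
      all_goals exact hna _ _ (by omega) (by omega)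
  -- the order
  obtain ⟨Np, hNp⟩ : ∃ Np : V → Finset V, ∀ x y, y ∈ Np x ↔ G.Adj x y ∧ D y = D x + 1 :=
    ⟨fun x => Finset.univ.filter (fun y => G.Adj x y ∧ D y = D x + 1), fun x y => by simp⟩
  obtain ⟨Nm, hNm⟩ : ∃ Nm : V → Finset V, ∀ x y, y ∈ Nm x ↔ G.Adj x y ∧ D y + 1 = D x :=
    ⟨fun x => Finset.univ.filter (fun y => G.Adj x y ∧ D y + 1 = D x), fun x y => by simp⟩
  have nestp : ∀ x y, D x = D y → ∀ x', x' ∈ Np x → x' ∉ Np y → Np y ⊆ Np x := by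
    intro x y hxy x' hx' hy' z hz
    by_contra hzx
    rw [hNp] at hx' hy' hz hzx
    by_cases h0 : D x = 0
    · have e1 := (hD0 x).1 (by omega)
      have e2 := (hD0 y).1 (by omega)
      subst e1; subst e2; exact hzx hz
    · exact C1 (D x) (by omega) x y x' z rfl hxy.symm hx'.1 hz.1 (fun hh => hy' ⟨hh, by omega⟩)
        (fun hh => hzx ⟨hh, by omega⟩) hx'.2 (by omega)
  have nestm : ∀ x y, D x = D y → ∀ x', x' ∈ Nm x → x' ∉ Nm y → Nm y ⊆ Nm x := by
    intro x y hxy x' hx' hy' z hz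
    by_contra hzx
    rw [hNm] at hx' hy' hz hzx
    exact C1m (D x) x y x' z rfl hxy.symm hx'.1.symm (fun hh => hy' ⟨hh.symm, by omega⟩) hz.1.symm
        (fun hh => hzx ⟨hh.symm, by omega⟩) hx'.2 (by omega)
  have mixed : ∀ x y, D x = D y → ∀ p, p ∈ Nm x → p ∉ Nm y → ∀ x', x' ∈ Np x → x' ∈ Np y := by
    intro x y hxy p hp hpy x' hx'
    by_contra hy'
    rw [hNm] at hp hpy
    rw [hNp] at hx' hy'
    exact C3 (D x) x y p x' rfl hxy.symm hp.2 hp.1.symm (fun hh => hpy ⟨hh.symm, by omega⟩) hx'.2 hx'.1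
      (fun hh => hy' ⟨hh, by omega⟩)
  obtain ⟨n, hn⟩ : ∃ n, n = Fintype.card V := ⟨_, rfl⟩
  have hcp : ∀ x, (Np x).card ≤ n := fun x => hn ▸ Finset.card_le_univ _
  have hcm : ∀ x, (Nm x).card ≤ n := fun x => hn ▸ Finset.card_le_univ _
  obtain ⟨e, he, hen⟩ : ∃ e : V → ℕ, Function.Injective e ∧ ∀ x, e x < n :=
    ⟨fun x => (Fintype.equivFin V x : ℕ), fun x y hxy => (Fintype.equivFin V).injective (Fin.ext hxy),
      fun x => hn ▸ (Fintype.equivFin V x).2⟩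
  obtain ⟨ψ, hψ⟩ : ∃ ψ : V → ℕ, ∀ x, ψ x + (Nm x).card = (Np x).card + n :=
    ⟨fun x => (Np x).card + n - (Nm x).card, fun x => by have := hcm x; dsimp only; omega⟩
  have mono : ∀ x y, D x = D y → ψ x ≤ ψ y → Nm y ⊆ Nm x ∧ Np x ⊆ Np y := by
    intro x y hxy hle
    have hx := hψ x
    have hy := hψ y
    constructor
    · intro p hp
      by_contra hpx
      have h1 := nestm y x hxy.symm p hp hpx
      have h2 : Np y ⊆ Np x := fun z hz => mixed y x hxy.symm p hp hpx z hz
      have h3 := Finset.card_lt_card (Finset.ssubset_iff_subset_ne.2 ⟨h1, fun e => hpx (e ▸ hp)⟩)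
      have h4 := Finset.card_le_card h2
      omega
    · intro x' hx'
      by_contra hy'
      have h1 := nestp x y hxy x' hx' hy'
      have h2 : Nm x ⊆ Nm y := by
        intro z hz
        by_contra hzy
        exact hy' (mixed x y hxy z hz hzy x' hx')
      have h3 := Finset.card_lt_card (Finset.ssubset_iff_subset_ne.2 ⟨h1, fun e => hy' (e ▸ hx')⟩)
      have h4 := Finset.card_le_card h2
      omega
  have hψlt : ∀ x, ψ x < 2 * n + 1 := by
    intro x
    have := hψ x
    have := hcp x
    omega
  have lexg : ∀ x y, (D x * (2 * n + 1) + ψ x) * n + e x ≤ (D y * (2 * n + 1) + ψ y) * n + e y →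
      D x < D y ∨ (D x = D y ∧ Nm y ⊆ Nm x ∧ Np x ⊆ Np y) := by
    intro x y hxy
    rcases lex_le (hen y) (hψlt y) hxy with h1 | ⟨h1, h2⟩
    · exact Or.inl h1
    · exact Or.inr ⟨h1, mono x y h1 h2⟩
  obtain ⟨χ, hχ⟩ := h.bip
  have hDχ : ∀ x y, χ x = χ y → D x % 2 = D y % 2 := by
    have key : ∀ i x, D x = i → (χ x = χ u ↔ i % 2 = 0) := by
      intro i
      induction i with
      | zero => intro x hx; rw [hD0] at hx; simp [hx]
      | succ i ih =>
        intro x hx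
        obtain ⟨y, hyx, hy⟩ := hDp x i hx
        have h1 := ih y hy
        have h2 := hχ _ _ hyx
        have : (i + 1) % 2 = 0 ↔ ¬ i % 2 = 0 := by omega
        rw [this, ← h1]
        revert h2
        generalize χ x = a
        generalize χ y = b
        generalize χ u = c
        revert a b c
        decide
    intro x y hxy
    have h1 := key _ x rfl
    have h2 := key _ y rfl
    rw [hxy, h2] at h1
    omega
  refine lay_of_order hd χ hχ (fun x => (D x * (2 * n + 1) + ψ x) * n + e x) ?_ ?_ hiso h.K
  · intro x y hxy
    dsimp only at hxy
    apply he
    have h1 := congrArg (fun t => t % n) hxy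
    simp only [Nat.mul_add_mod_self_right] at h1
    rwa [Nat.mod_eq_of_lt (hen x), Nat.mod_eq_of_lt (hen y)] at h1
  · intro a a' b b' hga hgb hab' ha'b hcol
    have hpar := hDχ a a' hcol
    have l1 := lexg a a' hga
    have l2 := lexg b b' hgb
    have d1 := hDa a b' hab'
    have d2 := hDa a' b ha'b
    have mp : ∀ x y z, Np x ⊆ Np y → G.Adj x z → D z = D x + 1 → G.Adj y z :=
      fun x y z hs ha hz => ((hNp y z).1 (hs ((hNp x z).2 ⟨ha, hz⟩))).1
    have mm : ∀ x y z, Nm x ⊆ Nm y → G.Adj x z → D z + 1 = D x → G.Adj y z :=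
      fun x y z hs ha hz => ((hNm y z).1 (hs ((hNm x z).2 ⟨ha, hz⟩))).1
    rcases l1 with l1 | ⟨l1, m1, p1⟩
    · rcases l2 with l2 | ⟨l2, m2, p2⟩
      · omega
      · exact ⟨(mm b' b a m2 hab'.symm (by omega)).symm, (mp b b' a' p2 ha'b.symm (by omega)).symm⟩
    · rcases l2 with l2 | ⟨l2, m2, p2⟩
      · exact ⟨mm a' a b m1 ha'b (by omega), mp a a' b' p1 hab' (by omega)⟩
      · rcases d1 with d1 | d1
        · exact ⟨(mm b' b a m2 hab'.symm (by omega)).symm, mp a a' b' p1 hab' (by omega)⟩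
        · exact ⟨mm a' a b m1 ha'b (by omega), (mp b b' a' p2 ha'b.symm (by omega)).symm⟩

theorem copy_of_map {V W : Type*} {G : SimpleGraph V} {H : SimpleGraph W} (f : W → V)
    (hinj : Function.Injective f) (hf : ∀ i j, G.Adj (f i) (f j) ↔ H.Adj i j) : HasInducedCopy G H := by
  refine ⟨Set.range f, ⟨RelIso.symm ⟨Equiv.ofInjective f hinj, ?_⟩⟩⟩
  intro i j
  simpa using hf i j

theorem copy_seven {V : Type*} {G : SimpleGraph V} (χ : V → Bool) (hχ : ∀ u v, G.Adj u v → χ u ≠ χ v)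
    {H : SimpleGraph (Fin 7)} (tw : ∀ i j, (∀ k, H.Adj i k ↔ H.Adj j k) → i = j)
    (f : Fin 7 → V) (b : Fin 7 → Bool) (hb : ∀ i j, H.Adj i j → b i ≠ b j) (c : Bool)
    (hc : ∀ i, χ (f i) = xor c (b i))
    (hf : ∀ i j, b i = true → b j = false → (G.Adj (f i) (f j) ↔ H.Adj i j)) : HasInducedCopy G H := by
  have hall : ∀ i j, G.Adj (f i) (f j) ↔ H.Adj i j := by
    intro i j
    cases hi : b i <;> cases hj : b j
    · constructor
      · intro ha; exact absurd (by rw [hc, hc, hi, hj]) (hχ _ _ ha)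
      · intro ha; exact absurd (by rw [hi, hj]) (hb _ _ ha)
    · rw [G.adj_comm, hf j i hj hi, H.adj_comm]
    · exact hf i j hi hj
    · constructor
      · intro ha; exact absurd (by rw [hc, hc, hi, hj]) (hχ _ _ ha)
      · intro ha; exact absurd (by rw [hi, hj]) (hb _ _ ha)
  refine copy_of_map f (fun i j hij => tw i j fun k => ?_) hall
  rw [← hall, ← hall, hij]

theorem Cls.of_hyps {V : Type*} (d : ℕ) (G : SimpleGraph V) (hbip : IsBipartiteGraph G)
    (harmchair : ¬ HasInducedCopy G armchair)
    (hstirrer : ¬ HasInducedCopy G stirrer)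
    (htripod : ¬ HasInducedCopy G tripod)
    (hK : ¬ HasInducedCopy G (completeBipartiteGraph (Fin (d + 1)) (Fin (d + 1)))) : Cls d G := by
  obtain ⟨χ, hχ⟩ : ∃ χ : V → Bool, ∀ u v, G.Adj u v → χ u ≠ χ v := by
    obtain ⟨A, B, hAB, hdis, hA, hB⟩ := hbip
    refine ⟨fun v => decide (v ∈ A), fun u v huv heq => ?_⟩
    have heq' : u ∈ A ↔ v ∈ A := by simpa using heq
    by_cases hu : u ∈ A
    · exact hA hu (heq'.1 hu) huv
    · have hu' : u ∈ A ∪ B := hAB ▸ Set.mem_univ u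
      have hv' : v ∈ A ∪ B := hAB ▸ Set.mem_univ v
      have hv : v ∉ A := fun hh => hu (heq'.2 hh)
      exact hB (hu'.resolve_left hu) (hv'.resolve_left hv) huv
  have two : ∀ x y, G.Adj x y → χ y = !(χ x) := by
    intro x y hxy
    have := hχ _ _ hxy
    revert this
    generalize χ x = a; generalize χ y = b
    revert a b; decide
  refine ⟨⟨χ, hχ⟩, ?_, ?_, ?_, ?_⟩
  · intro c1 c3 p2 c2 c4 p1 p3 h1 h2 h3 h4 h5 h6 h7 h8 h9 h10 h11 h12
    refine harmchair (copy_seven χ hχ armchair_tw ![c1, c2, c3, c4, p1, p2, p3]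
      ![true, false, true, false, false, true, false] ?_ (! (χ c1)) ?_ ?_)
    · simp only [armchair, SimpleGraph.fromRel_adj]; decide
    · have e2 := two _ _ h1
      have e4 := two _ _ h2
      have e5 := two _ _ h3
      have e3 := two _ _ h5.symm
      have e7 := two _ _ h8
      have e6 := two _ _ h9.symm
      intro i; fin_cases i <;> simp [*]
    · intro i j hi hj
      fin_cases i <;> simp at hi <;> fin_cases j <;> simp at hj <;> simp [armchair, *]
  · intro v0 v2 v4 v1 v3 v5 v6 h1 h2 h3 h4 h5 h6 h7 h8 h9 h10 h11 h12
    refine hstirrer (copy_seven χ hχ stirrer_tw ![v0, v1, v2, v3, v4, v5, v6]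
      ![true, false, true, false, true, false, false] ?_ (! (χ v0)) ?_ ?_)
    · simp only [stirrer, SimpleGraph.fromRel_adj]; decide
    · have e1 := two _ _ h1
      have e3 := two _ _ h2
      have e5 := two _ _ h3
      have e6 := two _ _ h4
      have e2 := two _ _ h5.symm
      have e4 := two _ _ h9.symm
      intro i; fin_cases i <;> simp [*]
    · intro i j hi hj
      fin_cases i <;> simp at hi <;> fin_cases j <;> simp at hj <;> simp [stirrer, *]
  · intro v0 v2 v4 v6 v1 v3 v5 h1 h2 h3 h4 h5 h6 h7 h8 h9 h10 h11 h12
    refine htripod (copy_seven χ hχ tripod_tw ![v0, v1, v2, v3, v4, v5, v6]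
      ![true, false, true, false, true, false, true] ?_ (! (χ v0)) ?_ ?_)
    · simp only [tripod, SimpleGraph.fromRel_adj]; decide
    · have e1 := two _ _ h1
      have e3 := two _ _ h2
      have e5 := two _ _ h3
      have e2 := two _ _ h4.symm
      have e4 := two _ _ h8.symm
      have e6 := two _ _ h12.symm
      intro i; fin_cases i <;> simp [*]
    · intro i j hi hj
      fin_cases i <;> simp at hi <;> fin_cases j <;> simp at hj <;> simp [tripod, *]
  · intro P Q hPQ hP hQ
    obtain ⟨P', hP', hPc⟩ := Finset.exists_subset_card_eq hP
    obtain ⟨Q', hQ', hQc⟩ := Finset.exists_subset_card_eq hQ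
    have eP := (Finset.equivFinOfCardEq hPc).symm
    have eQ := (Finset.equivFinOfCardEq hQc).symm
    have hadj : ∀ i j, G.Adj (eP i : V) (eQ j : V) := fun i j => hPQ _ (hP' (eP i).2) _ (hQ' (eQ j).2)
    refine hK (copy_of_map (Sum.elim (fun i => (eP i : V)) (fun j => (eQ j : V))) ?_ ?_)
    · rintro (i | i) (j | j) hij
      · simp only [Sum.elim_inl] at hij
        rw [eP.injective (Subtype.ext hij)]
      · simp only [Sum.elim_inl, Sum.elim_inr] at hij
        exact absurd hij (hadj i j).ne
      · simp only [Sum.elim_inl, Sum.elim_inr] at hij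
        exact absurd hij (hadj j i).ne'
      · simp only [Sum.elim_inr] at hij
        rw [eQ.injective (Subtype.ext hij)]
    · rintro (i | i) (j | j)
      · simp only [Sum.elim_inl, completeBipartiteGraph_adj]
        have e1 := two _ _ (hadj i 0)
        have e2 := two _ _ (hadj j 0)
        simp only [Sum.isLeft_inl, Sum.isRight_inl]
        constructor
        · intro ha; exact absurd (by rw [e1] at e2; simpa using e2) (hχ _ _ ha)
        · simp
      · simpa using hadj i j
      · simpa using (hadj j i).symm
      · simp only [Sum.elim_inr, completeBipartiteGraph_adj]
        have e1 := two _ _ (hadj 0 i)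
        have e2 := two _ _ (hadj 0 j)
        constructor
        · intro ha; exact absurd (e1.trans e2.symm) (hχ _ _ ha)
        · simp

universe u

theorem exists_cut {V : Type*} (G : SimpleGraph V) [Nonempty V] (hc : ¬ G.Connected) :
    ∃ s : Set V, s.Nonempty ∧ sᶜ.Nonempty ∧ ∀ x ∈ s, ∀ y ∉ s, ¬ G.Adj x y := by
  rw [SimpleGraph.connected_iff] at hc
  have hp : ¬ G.Preconnected := fun h => hc ⟨h, inferInstance⟩
  unfold SimpleGraph.Preconnected at hp
  push Not at hp
  obtain ⟨u, v, huv⟩ := hp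
  refine ⟨{y | G.Reachable u y}, ⟨u, SimpleGraph.Reachable.refl u⟩, ⟨v, huv⟩, ?_⟩
  intro x hx y hy hxy
  exact hy (SimpleGraph.Reachable.trans hx hxy.reachable)

theorem lay_of_components {k : ℕ} (P : ∀ {V : Type u}, SimpleGraph V → Prop)
    (hind : ∀ {V : Type u} (G : SimpleGraph V) (s : Set V), P G → P (G.induce s))
    (hcon : ∀ {V : Type u} [Fintype V] (G : SimpleGraph V), P G → G.Connected → Lay G k) :
    ∀ (n : ℕ) {V : Type u} [Fintype V] (G : SimpleGraph V), Fintype.card V ≤ n → P G → Lay G k := by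
  intro n
  induction n with
  | zero =>
    intro V _ G hn _
    have : IsEmpty V := Fintype.card_eq_zero_iff.1 (by omega)
    exact ⟨fun _ => 0, fun x => isEmptyElim x, fun x => isEmptyElim x⟩
  | succ n ih =>
    intro V _ G hn hP
    by_cases hc : G.Connected
    · exact hcon G hP hc
    by_cases hV : Nonempty V
    swap
    · have : IsEmpty V := not_nonempty_iff.1 hV
      exact ⟨fun _ => 0, fun x => isEmptyElim x, fun x => isEmptyElim x⟩
    obtain ⟨s, ⟨a, ha⟩, ⟨b, hb⟩, hs⟩ := exists_cut G hc
    have h1 : ∀ inst : Fintype s, @Fintype.card s inst < Fintype.card V := fun inst =>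
      Fintype.card_lt_of_injective_of_notMem _ Subtype.val_injective (b := b)
        (fun ⟨x, hx⟩ => hb (hx ▸ x.2))
    have h2 : ∀ inst : Fintype (sᶜ : Set V), @Fintype.card (sᶜ : Set V) inst < Fintype.card V :=
      fun inst => Fintype.card_lt_of_injective_of_notMem _ Subtype.val_injective (b := a)
        (fun ⟨x, hx⟩ => x.2 (hx ▸ ha))
    exact Lay.split s hs (ih _ (Nat.le_of_lt_succ ((h1 _).trans_le hn)) (hind G s hP))
      (ih _ (Nat.le_of_lt_succ ((h2 _).trans_le hn)) (hind G sᶜ hP))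

theorem Cls.lay_of_holeFr {V : Type u} [Fintype V] {d : ℕ} (hd : 1 ≤ d) {G : SimpleGraph V}
    (h : Cls d G) (hH : HoleFr G) : Lay G (2 * d) :=
  lay_of_components (fun G => Cls d G ∧ HoleFr G) (fun _ s hG => ⟨hG.1.induce s, hG.2.induce s⟩)
    (fun _ hG hc => hG.1.lay_of_connected hd hG.2 hc) _ G le_rfl ⟨h, hH⟩

theorem Cls.lay {V : Type u} [Fintype V] {d : ℕ} (hd : 1 ≤ d) {G : SimpleGraph V}
    (h : Cls d G) : Lay G (4 * d) := by
  refine lay_of_components (fun G => Cls d G) (fun _ s hG => hG.induce s) ?_ _ G le_rfl h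
  intro V _ G h hc
  obtain ⟨v⟩ := hc.nonempty
  obtain ⟨w, hw⟩ := h.exists_deg_le hd v
  have h1 := (h.induce {x | G.Adj w x}ᶜ).lay_of_holeFr hd (HoleFr.of_delete h hc w)
  have h2 : ({x | G.Adj w x} : Set V).ncard ≤ 2 * d := by
    rw [← Set.ncard_coe_finset] at hw
    simpa using hw
  exact (Lay.delete _ h2 h1).mono (by omega)

/-- Every bipartite finite simple graph with no induced armchair, stirrer,
tripod or `K_{d+1,d+1}` has pathwidth at most `4d − 1`. -/
theorem fast_completeBipartiteFree_pathwidth_le {V : Type*} [Fintype V] (d : ℕ)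
    (hd : 1 ≤ d) (G : SimpleGraph V) (hbip : IsBipartiteGraph G)
    (harmchair : ¬ HasInducedCopy G armchair)
    (hstirrer : ¬ HasInducedCopy G stirrer)
    (htripod : ¬ HasInducedCopy G tripod)
    (hK : ¬ HasInducedCopy G (completeBipartiteGraph (Fin (d + 1)) (Fin (d + 1)))) :
    pathwidth G ≤ 4 * d - 1 := by
  exact ((Cls.of_hyps d G hbip harmchair hstirrer htripod hK).lay hd).pathwidth_le
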